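/- arXiv:1804.07230 — 11 statements merged into one kernel-verified Lean document; each statement's English description precedes it below -/
import Mathlib

section
/- There exists a constant C > 0 such that for every K ≥ 0, every measurable function m : ℝ → ℝ with |m(y)| ≤ K(1+|y|) for all y ∈ ℝ, and every continuously differentiable f : ℝ → ℝ with ‖f‖_𝔇 < ∞, one has ∫_ℝ m(y)² f(y)² e^{-y²/4} dy ≤ C K² ‖f‖_𝔇². In other words, multiplication by m is a bounded operator from the weighted Sobolev space 𝔇 to the weighted Lebesgue space ℋ, with operator norm controlled by sup_y |m(y)|/(1+|y|). -/
open MeasureTheory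

/-- Integrating `(y f² e^{-y²/4})'` over `[-R, R]` controls the weighted second moment of `f²`
by the Gaussian Sobolev norm. -/
lemma intervalIntegral_sq_mul_sq_mul_exp_le {f : ℝ → ℝ} (hf : ContDiff ℝ 1 f)
    (hint : Integrable (fun y : ℝ => ((f y) ^ 2 + (deriv f y) ^ 2) * Real.exp (-y ^ 2 / 4)))
    {R : ℝ} (hR : 0 ≤ R) :
    ∫ y in (-R)..R, y ^ 2 * (f y) ^ 2 * Real.exp (-y ^ 2 / 4) ≤
      16 * ∫ y : ℝ, ((f y) ^ 2 + (deriv f y) ^ 2) * Real.exp (-y ^ 2 / 4) := by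
  have hfc : Continuous f := hf.continuous
  have hdc : Continuous (deriv f) := hf.continuous_deriv le_rfl
  have hle : -R ≤ R := by linarith
  have hderiv (y : ℝ) : HasDerivAt (fun y : ℝ => y * (f y) ^ 2 * Real.exp (-y ^ 2 / 4))
      (((f y) ^ 2 + 2 * y * f y * deriv f y - y ^ 2 / 2 * (f y) ^ 2) *
        Real.exp (-y ^ 2 / 4)) y := by
    have h1 : HasDerivAt f (deriv f y) y := (hf.differentiable one_ne_zero y).hasDerivAt
    have h2 : HasDerivAt (fun y : ℝ => -y ^ 2 / 4) (-(y / 2)) y :=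
      (((hasDerivAt_id' y).pow 2).neg.div_const 4).congr_deriv (by simp; ring)
    exact (((hasDerivAt_id' y).mul (h1.pow 2)).mul h2.exp).congr_deriv (by simp; ring)
  have hftc := intervalIntegral.integral_eq_sub_of_hasDerivAt (a := -R) (b := R)
    (fun y _ => hderiv y) (Continuous.intervalIntegrable (by fun_prop) _ _)
  have hmono : ∫ y in (-R)..R, ((f y) ^ 2 + 2 * y * f y * deriv f y - y ^ 2 / 2 * (f y) ^ 2) *
        Real.exp (-y ^ 2 / 4) ≤
      ∫ y in (-R)..R, (4 * (((f y) ^ 2 + (deriv f y) ^ 2) * Real.exp (-y ^ 2 / 4)) -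
        1 / 4 * (y ^ 2 * (f y) ^ 2 * Real.exp (-y ^ 2 / 4))) := by
    refine intervalIntegral.integral_mono_on hle
      (Continuous.intervalIntegrable (by fun_prop) _ _)
      (Continuous.intervalIntegrable (by fun_prop) _ _) fun y _ => ?_
    have h : (f y) ^ 2 + 2 * y * f y * deriv f y - y ^ 2 / 2 * (f y) ^ 2 ≤
        4 * ((f y) ^ 2 + (deriv f y) ^ 2) - 1 / 4 * (y ^ 2 * (f y) ^ 2) := by
      nlinarith [sq_nonneg (y * f y / 2 - 2 * deriv f y), sq_nonneg (f y)]
    have := mul_le_mul_of_nonneg_right h (Real.exp_pos (-y ^ 2 / 4)).le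
    linarith
  rw [intervalIntegral.integral_sub (Continuous.intervalIntegrable (by fun_prop) _ _)
    (Continuous.intervalIntegrable (by fun_prop) _ _), intervalIntegral.integral_const_mul,
    intervalIntegral.integral_const_mul, hftc] at hmono
  have hwhole : ∫ y in (-R)..R, ((f y) ^ 2 + (deriv f y) ^ 2) * Real.exp (-y ^ 2 / 4) ≤
      ∫ y : ℝ, ((f y) ^ 2 + (deriv f y) ^ 2) * Real.exp (-y ^ 2 / 4) := by
    rw [intervalIntegral.integral_of_le hle]
    exact setIntegral_le_integral hint (Filter.Eventually.of_forall fun y => by positivity)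
  have hp : 0 ≤ R * (f R) ^ 2 * Real.exp (-R ^ 2 / 4) := by positivity
  have hn : 0 ≤ R * (f (-R)) ^ 2 * Real.exp (-(-R) ^ 2 / 4) := by positivity
  linarith

/-- The weighted second moment of `f²` is finite and controlled by the Gaussian Sobolev norm. -/
lemma integrable_sq_mul_sq_mul_exp_and_integral_le {f : ℝ → ℝ} (hf : ContDiff ℝ 1 f)
    (hint : Integrable (fun y : ℝ => ((f y) ^ 2 + (deriv f y) ^ 2) * Real.exp (-y ^ 2 / 4))) :
    Integrable (fun y : ℝ => y ^ 2 * (f y) ^ 2 * Real.exp (-y ^ 2 / 4)) ∧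
      ∫ y : ℝ, y ^ 2 * (f y) ^ 2 * Real.exp (-y ^ 2 / 4) ≤
        16 * ∫ y : ℝ, ((f y) ^ 2 + (deriv f y) ^ 2) * Real.exp (-y ^ 2 / 4) := by
  have hfc : Continuous f := hf.continuous
  have hcont : Continuous fun y : ℝ => y ^ 2 * (f y) ^ 2 * Real.exp (-y ^ 2 / 4) := by fun_prop
  have hbound := (Filter.eventually_ge_atTop (0 : ℝ)).mono fun R hR =>
    intervalIntegral_sq_mul_sq_mul_exp_le hf hint hR
  have hi : Integrable (fun y : ℝ => y ^ 2 * (f y) ^ 2 * Real.exp (-y ^ 2 / 4)) := by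
    refine integrable_of_intervalIntegral_norm_bounded
      (16 * ∫ y : ℝ, ((f y) ^ 2 + (deriv f y) ^ 2) * Real.exp (-y ^ 2 / 4))
      (fun R => (hcont.integrableOn_Icc (a := -R) (b := R)).mono_set Set.Ioc_subset_Icc_self)
      Filter.tendsto_neg_atTop_atBot Filter.tendsto_id (hbound.mono fun R hR => ?_)
    have hnorm (y : ℝ) : ‖y ^ 2 * (f y) ^ 2 * Real.exp (-y ^ 2 / 4)‖ =
        y ^ 2 * (f y) ^ 2 * Real.exp (-y ^ 2 / 4) := Real.norm_of_nonneg (by positivity)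
    simpa only [hnorm] using hR
  exact ⟨hi, le_of_tendsto (intervalIntegral_tendsto_integral hi
    Filter.tendsto_neg_atTop_atBot Filter.tendsto_id) hbound⟩

/-- Multiplication by a function `m` with `|m(y)| ≤ K (1 + |y|)` is a bounded
operator from the weighted Sobolev space `𝔇` to the weighted Lebesgue space `ℋ`:
there is a universal constant `C > 0` such that
`∫ m(y)² f(y)² e^{-y²/4} dy ≤ C K² ∫ (f(y)² + f'(y)²) e^{-y²/4} dy`. -/
theorem mult_bounded_D_to_H :
    ∃ C : ℝ, 0 < C ∧
      ∀ K : ℝ, 0 ≤ K →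
      ∀ m : ℝ → ℝ, Measurable m → (∀ y : ℝ, |m y| ≤ K * (1 + |y|)) →
      ∀ f : ℝ → ℝ, ContDiff ℝ 1 f →
        Integrable (fun y : ℝ => ((f y) ^ 2 + (deriv f y) ^ 2) * Real.exp (-y ^ 2 / 4)) →
        ∫ y : ℝ, (m y) ^ 2 * (f y) ^ 2 * Real.exp (-y ^ 2 / 4) ≤
          C * K ^ 2 * ∫ y : ℝ, ((f y) ^ 2 + (deriv f y) ^ 2) * Real.exp (-y ^ 2 / 4) := by
  refine ⟨34, by norm_num, fun K hK m _ hmK f hf hint => ?_⟩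
  obtain ⟨hi, hle⟩ := integrable_sq_mul_sq_mul_exp_and_integral_le hf hint
  calc ∫ y : ℝ, (m y) ^ 2 * (f y) ^ 2 * Real.exp (-y ^ 2 / 4)
      ≤ ∫ y : ℝ, 2 * K ^ 2 * (((f y) ^ 2 + (deriv f y) ^ 2) * Real.exp (-y ^ 2 / 4) +
          y ^ 2 * (f y) ^ 2 * Real.exp (-y ^ 2 / 4)) := by
        refine integral_mono_of_nonneg (Filter.Eventually.of_forall fun y => by positivity)
          ((hint.add hi).const_mul _) (Filter.Eventually.of_forall fun y => ?_)
        have hm : (m y) ^ 2 ≤ 2 * K ^ 2 * (1 + y ^ 2) := by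
          have h1 : (m y) ^ 2 ≤ (K * (1 + |y|)) ^ 2 := sq_le_sq' (abs_le.1 (hmK y)).1
            (abs_le.1 (hmK y)).2
          have h2 : (1 + |y|) ^ 2 ≤ 2 * (1 + y ^ 2) := by
            nlinarith [sq_nonneg (1 - |y|), sq_abs y]
          nlinarith [mul_le_mul_of_nonneg_left h2 (sq_nonneg K)]
        calc (m y) ^ 2 * (f y) ^ 2 * Real.exp (-y ^ 2 / 4)
            ≤ 2 * K ^ 2 * (1 + y ^ 2) * (f y) ^ 2 * Real.exp (-y ^ 2 / 4) := by gcongr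
          _ ≤ 2 * K ^ 2 * (1 + y ^ 2) * (f y) ^ 2 * Real.exp (-y ^ 2 / 4) +
              2 * K ^ 2 * (deriv f y) ^ 2 * Real.exp (-y ^ 2 / 4) :=
            le_add_of_nonneg_right (by positivity)
          _ = _ := by ring
    _ = 2 * K ^ 2 * ((∫ y : ℝ, ((f y) ^ 2 + (deriv f y) ^ 2) * Real.exp (-y ^ 2 / 4)) +
          ∫ y : ℝ, y ^ 2 * (f y) ^ 2 * Real.exp (-y ^ 2 / 4)) := by
        rw [integral_const_mul, integral_add hint hi]
    _ ≤ 34 * K ^ 2 * ∫ y : ℝ, ((f y) ^ 2 + (deriv f y) ^ 2) * Real.exp (-y ^ 2 / 4) := by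
        nlinarith [mul_le_mul_of_nonneg_left hle (sq_nonneg K)]
end

section
/- There exists a constant C > 0 such that for every K ≥ 0, every measurable function m : ℝ → ℝ with |m(y)| ≤ K(1+|y|)² for all y ∈ ℝ, and all continuously differentiable f, φ : ℝ → ℝ with ‖f‖_𝔇 < ∞ and ‖φ‖_𝔇 < ∞, one has |∫_ℝ m(y) f(y) φ(y) e^{-y²/4} dy| ≤ C K ‖f‖_𝔇 ‖φ‖_𝔇. In other words, multiplication by m is bounded from 𝔇 to its dual 𝔇*, with norm controlled by sup_y |m(y)|/(1+|y|)². -/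
open MeasureTheory

open Filter Set in
/-- A function that is nonnegative and continuous, with integrals over `[-R, R]` bounded by `B`,
is integrable with integral at most `B`. -/
lemma integrable_and_integral_le_of_intervalIntegral_le {g : ℝ → ℝ} (hg : Continuous g)
    (hg0 : ∀ y, 0 ≤ g y) {B : ℝ} (hB : ∀ R : ℝ, 0 ≤ R → ∫ y in (-R)..R, g y ≤ B) :
    Integrable g ∧ ∫ y, g y ≤ B := by
  have hint : Integrable g := by
    refine integrable_of_intervalIntegral_norm_bounded (l := atTop) (a := fun R : ℝ => -R)
      (b := fun R : ℝ => R) B (fun R => (hg.integrableOn_Icc).mono_set Ioc_subset_Icc_self)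
      tendsto_neg_atTop_atBot tendsto_id ?_
    filter_upwards [eventually_ge_atTop (0 : ℝ)] with R hR
    simpa only [Real.norm_of_nonneg (hg0 _)] using hB R hR
  refine ⟨hint, le_of_tendsto
    (intervalIntegral_tendsto_integral hint tendsto_neg_atTop_atBot tendsto_id) ?_⟩
  filter_upwards [eventually_ge_atTop (0 : ℝ)] with R hR using hB R hR

/-- Weighted Hardy-type inequality: the Gaussian-weighted Sobolev norm controls `y f`. -/
lemma gaussian_integral_sq_mul_sq_le {f : ℝ → ℝ} (hf : ContDiff ℝ 1 f)
    (hfi : Integrable (fun y : ℝ => ((f y) ^ 2 + (deriv f y) ^ 2) * Real.exp (-y ^ 2 / 4))) :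
    Integrable (fun y : ℝ => y ^ 2 * (f y) ^ 2 * Real.exp (-y ^ 2 / 4)) ∧
      ∫ y : ℝ, y ^ 2 * (f y) ^ 2 * Real.exp (-y ^ 2 / 4) ≤
        16 * ∫ y : ℝ, ((f y) ^ 2 + (deriv f y) ^ 2) * Real.exp (-y ^ 2 / 4) := by
  have hc : Continuous f := hf.continuous
  have hc' : Continuous (deriv f) := hf.continuous_deriv le_rfl
  refine integrable_and_integral_le_of_intervalIntegral_le (by fun_prop)
    (fun y => by positivity) fun R hR => ?_
  set w : ℝ → ℝ := fun y => Real.exp (-y ^ 2 / 4)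
  have hwc : Continuous w := by fun_prop
  set G' : ℝ → ℝ := fun y => f y ^ 2 * w y + 2 * y * f y * deriv f y * w y
    - y ^ 2 / 2 * f y ^ 2 * w y
  have hG'c : Continuous G' := by fun_prop
  have hderiv : ∀ y, HasDerivAt (fun y => y * f y ^ 2 * w y) (G' y) y := fun y => by
    have h1 : HasDerivAt f (deriv f y) y := (hf.differentiable one_ne_zero y).hasDerivAt
    have h2 : HasDerivAt w (w y * (-y / 2)) y := by
      have h3 : HasDerivAt (fun y : ℝ => -y ^ 2 / 4) (-y / 2) y :=
        (((hasDerivAt_id y).pow 2).neg.div_const 4).congr_deriv (by simp; ring)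
      exact h3.exp
    exact (((hasDerivAt_id y).mul (h1.pow 2)).mul h2).congr_deriv (by simp [G']; ring)
  have hftc : ∫ y in (-R)..R, G' y = R * f R ^ 2 * w R - -R * f (-R) ^ 2 * w (-R) :=
    intervalIntegral.integral_eq_sub_of_hasDerivAt (fun y _ => hderiv y)
      (hG'c.intervalIntegrable _ _)
  have hboundary : 0 ≤ ∫ y in (-R)..R, G' y := by
    have h1 : 0 ≤ R * f R ^ 2 * w R := by positivity
    have h2 : 0 ≤ R * f (-R) ^ 2 * w (-R) := by positivity
    linarith
  have hpoint : ∀ y, y ^ 2 * f y ^ 2 * w y ≤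
      16 * ((f y ^ 2 + deriv f y ^ 2) * w y) - 4 * G' y := fun y => by
    have h : 0 ≤ ((y * f y - 4 * deriv f y) ^ 2 + 12 * f y ^ 2) * w y := by positivity
    simp only [G']
    linarith
  have hnc : Continuous fun y => (f y ^ 2 + deriv f y ^ 2) * w y := by fun_prop
  calc ∫ y in (-R)..R, y ^ 2 * f y ^ 2 * w y
      ≤ ∫ y in (-R)..R, (16 * ((f y ^ 2 + deriv f y ^ 2) * w y) - 4 * G' y) :=
        intervalIntegral.integral_mono_on (by linarith)
          (Continuous.intervalIntegrable (by fun_prop) _ _)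
          (Continuous.intervalIntegrable (by fun_prop) _ _) fun y _ => hpoint y
    _ = 16 * (∫ y in (-R)..R, (f y ^ 2 + deriv f y ^ 2) * w y) - 4 * ∫ y in (-R)..R, G' y := by
        rw [intervalIntegral.integral_sub ((hnc.const_mul 16).intervalIntegrable _ _)
          ((hG'c.const_mul 4).intervalIntegrable _ _), intervalIntegral.integral_const_mul,
          intervalIntegral.integral_const_mul]
    _ ≤ 16 * ∫ y in (-R)..R, (f y ^ 2 + deriv f y ^ 2) * w y := by linarith
    _ ≤ 16 * ∫ y, (f y ^ 2 + deriv f y ^ 2) * w y := by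
        gcongr
        rw [intervalIntegral.integral_of_le (by linarith)]
        exact setIntegral_le_integral hfi (Filter.Eventually.of_forall fun y => by positivity)

/-- The function `(1 + |y|) |f|` belongs to the Gaussian-weighted `L²` space, with norm controlled
by the Gaussian-weighted Sobolev norm of `f`. -/
lemma gaussian_integral_one_add_abs_mul_sq_le {f : ℝ → ℝ} (hf : ContDiff ℝ 1 f)
    (hfi : Integrable (fun y : ℝ => ((f y) ^ 2 + (deriv f y) ^ 2) * Real.exp (-y ^ 2 / 4))) :
    Integrable (fun y : ℝ => ((1 + |y|) * |f y| * Real.exp (-y ^ 2 / 8)) ^ 2) ∧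
      ∫ y : ℝ, ((1 + |y|) * |f y| * Real.exp (-y ^ 2 / 8)) ^ 2 ≤
        34 * ∫ y : ℝ, ((f y) ^ 2 + (deriv f y) ^ 2) * Real.exp (-y ^ 2 / 4) := by
  obtain ⟨hi, hle⟩ := gaussian_integral_sq_mul_sq_le hf hfi
  have hc : Continuous f := hf.continuous
  have hdom := (hfi.const_mul 2).add (hi.const_mul 2)
  have hpoint : ∀ y : ℝ, ((1 + |y|) * |f y| * Real.exp (-y ^ 2 / 8)) ^ 2 ≤
      2 * (((f y) ^ 2 + (deriv f y) ^ 2) * Real.exp (-y ^ 2 / 4)) +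
        2 * (y ^ 2 * (f y) ^ 2 * Real.exp (-y ^ 2 / 4)) := fun y => by
    have he : Real.exp (-y ^ 2 / 8) ^ 2 = Real.exp (-y ^ 2 / 4) := by
      rw [← Real.exp_nat_mul]; congr 1; push_cast; ring
    have h : 0 ≤ ((1 - |y|) ^ 2 * f y ^ 2 + 2 * deriv f y ^ 2) * Real.exp (-y ^ 2 / 4) := by
      positivity
    rw [mul_pow, mul_pow, he, sq_abs]
    rw [← sq_abs y] at *
    linarith
  have hint : Integrable (fun y : ℝ => ((1 + |y|) * |f y| * Real.exp (-y ^ 2 / 8)) ^ 2) :=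
    hdom.mono' (Continuous.aestronglyMeasurable (by fun_prop)) <| .of_forall fun y => by
      rw [Real.norm_of_nonneg (by positivity)]
      exact hpoint y
  refine ⟨hint, (integral_mono hint hdom hpoint).trans ?_⟩
  simp only [Pi.add_apply]
  rw [integral_add (hfi.const_mul 2) (hi.const_mul 2), integral_const_mul, integral_const_mul]
  linarith

/-- Cauchy–Schwarz for nonnegative functions whose squares are integrable. -/
lemma integral_mul_le_sqrt_mul_sqrt {α : Type*} [MeasurableSpace α] {μ : Measure α} {g h : α → ℝ}
    (hg0 : ∀ x, 0 ≤ g x) (hh0 : ∀ x, 0 ≤ h x)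
    (hgm : AEStronglyMeasurable g μ) (hhm : AEStronglyMeasurable h μ)
    (hg : Integrable (fun x => g x ^ 2) μ) (hh : Integrable (fun x => h x ^ 2) μ) :
    ∫ x, g x * h x ∂μ ≤ √(∫ x, g x ^ 2 ∂μ) * √(∫ x, h x ^ 2 ∂μ) := by
  have H := integral_mul_le_Lp_mul_Lq_of_nonneg (μ := μ) (f := g) (g := h)
    Real.HolderConjugate.two_two (.of_forall hg0) (.of_forall hh0)
    (by simpa using (memLp_two_iff_integrable_sq hgm).2 hg)
    (by simpa using (memLp_two_iff_integrable_sq hhm).2 hh)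
  simpa [Real.sqrt_eq_rpow] using H

/-- Multiplication by a function `m` with `|m(y)| ≤ K (1 + |y|)²` is a bounded
operator from `𝔇` to its dual `𝔇*`: there is a universal constant `C > 0` such that
`|∫ m f φ e^{-y²/4} dy| ≤ C K ‖f‖_𝔇 ‖φ‖_𝔇` for all `C¹` functions `f, φ`
with finite `𝔇`-norm. -/
theorem mult_bounded_D_to_Dstar :
    ∃ C : ℝ, 0 < C ∧
      ∀ K : ℝ, 0 ≤ K →
      ∀ m : ℝ → ℝ, Measurable m → (∀ y : ℝ, |m y| ≤ K * (1 + |y|) ^ 2) →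
      ∀ f φ : ℝ → ℝ, ContDiff ℝ 1 f → ContDiff ℝ 1 φ →
        Integrable (fun y : ℝ => ((f y) ^ 2 + (deriv f y) ^ 2) * Real.exp (-y ^ 2 / 4)) →
        Integrable (fun y : ℝ => ((φ y) ^ 2 + (deriv φ y) ^ 2) * Real.exp (-y ^ 2 / 4)) →
        |∫ y : ℝ, m y * f y * φ y * Real.exp (-y ^ 2 / 4)| ≤
          C * K * Real.sqrt (∫ y : ℝ, ((f y) ^ 2 + (deriv f y) ^ 2) * Real.exp (-y ^ 2 / 4))
            * Real.sqrt (∫ y : ℝ, ((φ y) ^ 2 + (deriv φ y) ^ 2) * Real.exp (-y ^ 2 / 4)) := by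
  refine ⟨34, by norm_num, fun K hK m _ hmK f φ hf hφ hfi hφi => ?_⟩
  obtain ⟨hF, hFle⟩ := gaussian_integral_one_add_abs_mul_sq_le hf hfi
  obtain ⟨hP, hPle⟩ := gaussian_integral_one_add_abs_mul_sq_le hφ hφi
  have hfc : Continuous f := hf.continuous
  have hφc : Continuous φ := hφ.continuous
  set F : ℝ → ℝ := fun y => (1 + |y|) * |f y| * Real.exp (-y ^ 2 / 8)
  set P : ℝ → ℝ := fun y => (1 + |y|) * |φ y| * Real.exp (-y ^ 2 / 8)
  have hF0 : ∀ y, 0 ≤ F y := fun y => by positivity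
  have hP0 : ∀ y, 0 ≤ P y := fun y => by positivity
  have hFm : AEStronglyMeasurable F := Continuous.aestronglyMeasurable (by fun_prop)
  have hPm : AEStronglyMeasurable P := Continuous.aestronglyMeasurable (by fun_prop)
  have hFP : Integrable fun y => F y * P y :=
    ((memLp_two_iff_integrable_sq hFm).2 hF).integrable_mul
      ((memLp_two_iff_integrable_sq hPm).2 hP)
  have hpoint : ∀ y, ‖m y * f y * φ y * Real.exp (-y ^ 2 / 4)‖ ≤ K * (F y * P y) := fun y => by
    have he : Real.exp (-y ^ 2 / 4) = Real.exp (-y ^ 2 / 8) * Real.exp (-y ^ 2 / 8) := by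
      rw [← Real.exp_add]; congr 1; ring
    rw [norm_mul, norm_mul, norm_mul, Real.norm_of_nonneg (Real.exp_pos _).le, Real.norm_eq_abs,
      Real.norm_eq_abs, Real.norm_eq_abs]
    calc |m y| * |f y| * |φ y| * Real.exp (-y ^ 2 / 4)
        ≤ K * (1 + |y|) ^ 2 * |f y| * |φ y| * Real.exp (-y ^ 2 / 4) := by
          gcongr
          exact hmK y
      _ = K * (F y * P y) := by
          rw [he]
          simp only [F, P]
          ring
  set A := ∫ y : ℝ, ((f y) ^ 2 + (deriv f y) ^ 2) * Real.exp (-y ^ 2 / 4)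
  set B := ∫ y : ℝ, ((φ y) ^ 2 + (deriv φ y) ^ 2) * Real.exp (-y ^ 2 / 4)
  calc |∫ y : ℝ, m y * f y * φ y * Real.exp (-y ^ 2 / 4)|
      ≤ ∫ y, K * (F y * P y) :=
        norm_integral_le_of_norm_le (hFP.const_mul K) (.of_forall hpoint)
    _ = K * ∫ y, F y * P y := integral_const_mul _ _
    _ ≤ K * (√(∫ y, F y ^ 2) * √(∫ y, P y ^ 2)) := by
        gcongr
        exact integral_mul_le_sqrt_mul_sqrt hF0 hP0 hFm hPm hF hP
    _ ≤ K * (√(34 * A) * √(34 * B)) := by gcongr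
    _ = 34 * K * √A * √B := by
        rw [Real.sqrt_mul (by norm_num), Real.sqrt_mul (by norm_num)]
        linear_combination (K * √A * √B) * Real.mul_self_sqrt (show (0 : ℝ) ≤ 34 by norm_num)
end

section
/- Every continuously differentiable function f : ℝ → ℝ with ‖f‖_𝔇 < ∞ that satisfies the three orthogonality conditions ⟨f, 1⟩ = 0, ⟨f, y⟩ = 0 and ⟨f, y²-2⟩ = 0 obeys the spectral-gap inequality ∫_ℝ f'(y)² e^{-y²/4} dy ≥ (3/2) ∫_ℝ f(y)² e^{-y²/4} dy. Equivalently, on the orthogonal complement of the span of 1, y, y²-2 the quadratic form of the operator ℒ = ∂_y² - (y/2)∂_y + 1 satisfies ⟨ℒf, f⟩ ≤ -(1/2)‖f‖_ℋ². -/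
open MeasureTheory

open Set Filter Topology

/-- The Gaussian weight `e^{-y²/4}`. -/
noncomputable def gaussWeight (y : ℝ) : ℝ := Real.exp (-y ^ 2 / 4)

lemma gaussWeight_pos (y : ℝ) : 0 < gaussWeight y := Real.exp_pos _

lemma hasDerivAt_gaussWeight (y : ℝ) :
    HasDerivAt gaussWeight (-(y / 2) * gaussWeight y) y := by
  have h : HasDerivAt (fun y : ℝ => -y ^ 2 / 4) (-(y / 2)) y := by
    refine ((hasDerivAt_pow 2 y).neg.div_const 4).congr_deriv ?_
    norm_num
    ring
  exact h.exp.congr_deriv (mul_comm _ _)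

@[fun_prop]
lemma continuous_gaussWeight : Continuous gaussWeight := by
  unfold gaussWeight
  fun_prop

lemma gaussWeight_neg (y : ℝ) : gaussWeight (-y) = gaussWeight y := by
  simp [gaussWeight]

lemma integrable_pow_mul_gaussWeight (n : ℕ) :
    Integrable (fun y : ℝ => y ^ n * gaussWeight y) := by
  have h := integrable_rpow_mul_exp_neg_mul_sq (b := 1 / 4) (by norm_num) (s := n)
    (by linarith [n.cast_nonneg (α := ℝ)])
  refine h.congr (ae_of_all _ fun y => ?_)
  simp only [gaussWeight, Real.rpow_natCast]
  ring_nf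

lemma integrable_gaussWeight : Integrable gaussWeight := by
  simpa using integrable_pow_mul_gaussWeight 0

/-- The product of two functions in the Gaussian `L²` space is integrable. -/
lemma integrable_mul_mul_gaussWeight {a b : ℝ → ℝ} (ha : Continuous a) (hb : Continuous b)
    (ha2 : Integrable fun y => a y ^ 2 * gaussWeight y)
    (hb2 : Integrable fun y => b y ^ 2 * gaussWeight y) :
    Integrable fun y => a y * b y * gaussWeight y := by
  refine (ha2.add hb2).mono' (by fun_prop) (ae_of_all _ fun y => ?_)
  have hw := gaussWeight_pos y
  rw [Real.norm_eq_abs, abs_mul, abs_of_pos hw, Pi.add_apply, ← add_mul]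
  refine mul_le_mul_of_nonneg_right ?_ hw.le
  rw [abs_le]
  constructor <;> nlinarith [sq_nonneg (a y + b y), sq_nonneg (a y - b y)]

/-- The Cauchy–Schwarz inequality with respect to the Gaussian weight on a set. -/
lemma sq_setIntegral_mul_gaussWeight_le (s : Set ℝ) {a b : ℝ → ℝ}
    (ha : Continuous a) (hb : Continuous b)
    (ha2 : Integrable fun y => a y ^ 2 * gaussWeight y)
    (hb2 : Integrable fun y => b y ^ 2 * gaussWeight y) :
    (∫ y in s, a y * b y * gaussWeight y) ^ 2 ≤
      (∫ y in s, a y ^ 2 * gaussWeight y) * ∫ y in s, b y ^ 2 * gaussWeight y := by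
  have hab := (integrable_mul_mul_gaussWeight ha hb ha2 hb2).integrableOn (s := s)
  have key := discrim_le_zero (a := ∫ y in s, b y ^ 2 * gaussWeight y)
    (b := 2 * ∫ y in s, a y * b y * gaussWeight y)
    (c := ∫ y in s, a y ^ 2 * gaussWeight y) fun t => by
      have h : 0 ≤ ∫ y in s, (a y + t * b y) ^ 2 * gaussWeight y :=
        integral_nonneg fun y => mul_nonneg (sq_nonneg _) (gaussWeight_pos y).le
      have e : (fun y => (a y + t * b y) ^ 2 * gaussWeight y) = fun y =>
          t * t * (b y ^ 2 * gaussWeight y) + 2 * t * (a y * b y * gaussWeight y)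
            + a y ^ 2 * gaussWeight y := by
        ext y
        ring
      rw [e, integral_add _ ha2.integrableOn, integral_add (hb2.integrableOn.const_mul _)
        (hab.const_mul _), integral_const_mul, integral_const_mul] at h
      · linarith
      · exact (hb2.integrableOn.const_mul _).add (hab.const_mul _)
  rw [discrim] at key
  linarith

lemma tendsto_gaussWeight_atTop : Tendsto gaussWeight atTop (𝓝 0) := by
  refine Real.tendsto_exp_atBot.comp ?_
  have h : Tendsto (fun y : ℝ => y ^ 2) atTop atTop := tendsto_pow_atTop two_ne_zero
  exact (tendsto_neg_atTop_atBot.comp (h.atTop_div_const (r := 4) (by norm_num))).congr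
    fun y => (neg_div _ _).symm

lemma setIntegral_Ioi_gaussWeight_le (y : ℝ) :
    y * ∫ x in Ioi y, gaussWeight x ≤ 2 * gaussWeight y := by
  have hint : Integrable fun x : ℝ => x * gaussWeight x := by
    simpa using integrable_pow_mul_gaussWeight 1
  have h := integral_Ioi_of_hasDerivAt_of_tendsto' (f := fun x => -2 * gaussWeight x)
    (f' := fun x => x * gaussWeight x) (a := y) (m := -2 * 0)
    (fun x _ => by
      refine ((hasDerivAt_gaussWeight x).const_mul (-2)).congr_deriv ?_
      ring)
    hint.integrableOn (tendsto_gaussWeight_atTop.const_mul _)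
  have h' : ∫ x in Ioi y, y * gaussWeight x ≤ ∫ x in Ioi y, x * gaussWeight x :=
    setIntegral_mono_on (integrable_gaussWeight.const_mul _).integrableOn hint.integrableOn
      measurableSet_Ioi fun x hx =>
        mul_le_mul_of_nonneg_right (le_of_lt hx) (gaussWeight_pos x).le
  rw [integral_const_mul, h] at h'
  linarith

lemma sq_setIntegral_Ioi_le {f : ℝ → ℝ} (hf : Continuous f)
    (hf2 : Integrable fun y => f y ^ 2 * gaussWeight y) {y : ℝ} (hy : 0 < y) :
    y * (∫ x in Ioi y, f x * gaussWeight x) ^ 2 / gaussWeight y ≤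
      2 * ∫ x in Ioi y, f x ^ 2 * gaussWeight x := by
  have hcs := sq_setIntegral_mul_gaussWeight_le (Ioi y) hf (continuous_const (y := (1 : ℝ))) hf2
    (by simpa using integrable_gaussWeight)
  simp only [mul_one, one_pow, one_mul] at hcs
  have h := setIntegral_Ioi_gaussWeight_le y
  have h0 : 0 ≤ ∫ x in Ioi y, f x ^ 2 * gaussWeight x :=
    integral_nonneg fun x => mul_nonneg (sq_nonneg _) (gaussWeight_pos x).le
  rw [div_le_iff₀ (gaussWeight_pos y)]
  nlinarith [mul_le_mul_of_nonneg_left hcs hy.le, mul_le_mul_of_nonneg_left h h0]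

lemma tendsto_setIntegral_Ioi_atTop {f : ℝ → ℝ} (hf : Integrable f) :
    Tendsto (fun y : ℝ => ∫ x in Ioi y, f x) atTop (𝓝 0) := by
  have h := tendsto_setIntegral_of_antitone (μ := volume) (f := f) (s := fun y : ℝ => Ioi y)
    (fun _ => measurableSet_Ioi) (fun _ _ h => Ioi_subset_Ioi h) ⟨0, hf.integrableOn⟩
  have e : ⋂ y : ℝ, Ioi y = ∅ := by
    ext x
    simpa using ⟨x, le_rfl⟩
  simpa [e] using h

lemma tendsto_sq_setIntegral_Ioi {f : ℝ → ℝ} (hf : Continuous f)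
    (hf2 : Integrable fun y => f y ^ 2 * gaussWeight y) :
    Tendsto (fun y => y * (∫ x in Ioi y, f x * gaussWeight x) ^ 2 / gaussWeight y)
      atTop (𝓝 0) := by
  refine squeeze_zero' ?_ ?_ (by simpa using (tendsto_setIntegral_Ioi_atTop hf2).const_mul 2)
  · filter_upwards [eventually_gt_atTop 0] with y hy
    have := gaussWeight_pos y
    positivity
  · filter_upwards [eventually_gt_atTop 0] with y hy
    exact sq_setIntegral_Ioi_le hf hf2 hy

/-- A `C¹` function `g` with derivative `g'`, both square integrable for the Gaussian weight. -/
structure GaussSobolev (g g' : ℝ → ℝ) : Prop where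
  hasDerivAt : ∀ y, HasDerivAt g (g' y) y
  continuous_deriv : Continuous g'
  integrable_sq : Integrable fun y => g y ^ 2 * gaussWeight y
  integrable_deriv_sq : Integrable fun y => g' y ^ 2 * gaussWeight y

namespace GaussSobolev

variable {g g' h h' : ℝ → ℝ}

lemma continuous (hg : GaussSobolev g g') : Continuous g :=
  continuous_iff_continuousAt.2 fun y => (hg.hasDerivAt y).continuousAt

lemma pow (n : ℕ) : GaussSobolev (fun y => y ^ n) (fun y => n * y ^ (n - 1)) where
  hasDerivAt y := hasDerivAt_pow n y
  continuous_deriv := by fun_prop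
  integrable_sq := by
    simpa only [← pow_mul] using integrable_pow_mul_gaussWeight (n * 2)
  integrable_deriv_sq := by
    simpa only [mul_pow, ← pow_mul, mul_assoc] using
      (integrable_pow_mul_gaussWeight ((n - 1) * 2)).const_mul ((n : ℝ) ^ 2)

/-- `y/2 - ∂_y` is the formal adjoint of `∂_y` for the Gaussian weight. -/
lemma integral_mul_adjoint (hg : GaussSobolev g g') (hh : GaussSobolev h h')
    (hf : Integrable fun y => (y / 2 * g y - g' y) ^ 2 * gaussWeight y) :
    ∫ y, h y * (y / 2 * g y - g' y) * gaussWeight y = ∫ y, h' y * g y * gaussWeight y := by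
  have hgc := hg.continuous
  have hgc' := hg.continuous_deriv
  have key := integral_mul_deriv_eq_deriv_mul_of_integrable (u := h) (u' := h')
    (v := fun y => -(g y * gaussWeight y)) (v' := fun y => (y / 2 * g y - g' y) * gaussWeight y)
    (fun y _ => hh.hasDerivAt y)
    (fun y _ => by
      refine ((hg.hasDerivAt y).mul (hasDerivAt_gaussWeight y)).neg.congr_deriv ?_
      ring)
    ((integrable_mul_mul_gaussWeight hh.continuous (by fun_prop) hh.integrable_sq hf).congr
      (ae_of_all _ fun y => by simp only [Pi.mul_apply]; ring))
    ((integrable_mul_mul_gaussWeight hh.continuous_deriv hgc hh.integrable_deriv_sq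
      hg.integrable_sq).neg.congr
      (ae_of_all _ fun y => by simp only [Pi.mul_apply, Pi.neg_apply]; ring))
    ((integrable_mul_mul_gaussWeight hh.continuous hgc hh.integrable_sq
      hg.integrable_sq).neg.congr
      (ae_of_all _ fun y => by simp only [Pi.mul_apply, Pi.neg_apply]; ring))
  simpa [mul_assoc, MeasureTheory.integral_neg] using key

end GaussSobolev

lemma hasDerivAt_setIntegral_Iic {F : ℝ → ℝ} (hF : Continuous F) (hFi : Integrable F) (y : ℝ) :
    HasDerivAt (fun y => ∫ x in Iic y, F x) (F y) y := by
  have e : (fun y => ∫ x in Iic y, F x) = fun y => (∫ x in Iic 0, F x) + ∫ x in (0 : ℝ)..y, F x := by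
    ext z
    rw [← intervalIntegral.integral_Iic_sub_Iic hFi.integrableOn hFi.integrableOn]
    ring
  rw [e]
  exact (hF.integral_hasStrictDerivAt 0 y).hasDerivAt.const_add _

/-- Boundary terms in the energy identity vanish at both ends. -/
lemma tendsto_sq_setIntegral_Iic {f : ℝ → ℝ} (hf : Continuous f)
    (hf2 : Integrable fun y => f y ^ 2 * gaussWeight y)
    (h0 : ∫ y, f y * gaussWeight y = 0) :
    Tendsto (fun y => y * (∫ x in Iic y, f x * gaussWeight x) ^ 2 / gaussWeight y)
        atTop (𝓝 0) ∧
      Tendsto (fun y => (-y) * (∫ x in Iic (-y), f x * gaussWeight x) ^ 2 / gaussWeight (-y))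
        atTop (𝓝 0) := by
  have hfi : Integrable fun y => f y * gaussWeight y := by
    simpa using integrable_mul_mul_gaussWeight hf (continuous_const (y := (1 : ℝ))) hf2
      (by simpa using integrable_gaussWeight)
  constructor
  · refine (tendsto_sq_setIntegral_Ioi hf hf2).congr fun y => ?_
    have h := intervalIntegral.integral_Iic_add_Ioi (b := y) hfi.integrableOn hfi.integrableOn
    rw [h0] at h
    rw [eq_neg_of_add_eq_zero_left h, neg_sq]
  · have h := (tendsto_sq_setIntegral_Ioi (f := fun y => f (-y)) (by fun_prop)
      (by simpa only [gaussWeight_neg] using hf2.comp_neg)).neg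
    rw [neg_zero] at h
    refine h.congr fun y => ?_
    have e := integral_comp_neg_Ioi y fun x => f x * gaussWeight x
    simp only [gaussWeight_neg] at e
    rw [e, gaussWeight_neg]
    ring

/-- A centred function is in the range of `y/2 - ∂_y`, with the energy identity coming from
the commutator of `∂_y` and its adjoint. -/
lemma exists_gaussSobolev_adjoint_eq {f : ℝ → ℝ} (hf : Continuous f)
    (hf2 : Integrable fun y => f y ^ 2 * gaussWeight y)
    (h0 : ∫ y, f y * gaussWeight y = 0) :
    ∃ g g' : ℝ → ℝ, GaussSobolev g g' ∧ (∀ y, f y = y / 2 * g y - g' y) ∧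
      ∫ y, f y ^ 2 * gaussWeight y =
        (∫ y, g' y ^ 2 * gaussWeight y) + 1 / 2 * ∫ y, g y ^ 2 * gaussWeight y := by
  have hfi : Integrable fun y => f y * gaussWeight y := by
    simpa using integrable_mul_mul_gaussWeight hf (continuous_const (y := (1 : ℝ))) hf2
      (by simpa using integrable_gaussWeight)
  let G : ℝ → ℝ := fun y => ∫ x in Iic y, f x * gaussWeight x
  have hG : ∀ y, HasDerivAt G (f y * gaussWeight y) y :=
    hasDerivAt_setIntegral_Iic (by fun_prop) hfi
  let g : ℝ → ℝ := fun y => -(G y / gaussWeight y)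
  let g' : ℝ → ℝ := fun y => y / 2 * g y - f y
  have hg : ∀ y, HasDerivAt g (g' y) y := fun y => by
    have hw := (gaussWeight_pos y).ne'
    refine ((hG y).div (hasDerivAt_gaussWeight y) hw).neg.congr_deriv ?_
    simp only [g', g]
    field_simp
    ring
  have hgc : Continuous g := continuous_iff_continuousAt.2 fun y => (hg y).continuousAt
  have hgc' : Continuous g' := by fun_prop
  let E : ℝ → ℝ := fun y => g' y ^ 2 * gaussWeight y + 1 / 2 * (g y ^ 2 * gaussWeight y)
  have hEc : Continuous E := by fun_prop
  have hE0 : ∀ y, 0 ≤ E y := fun y => by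
    have := gaussWeight_pos y
    positivity
  let T : ℝ → ℝ := fun y => y * G y ^ 2 / gaussWeight y
  have hT : ∀ y, HasDerivAt T (2 * (E y - f y ^ 2 * gaussWeight y)) y := fun y => by
    have hw := (gaussWeight_pos y).ne'
    refine (((hasDerivAt_id y).mul ((hG y).pow 2)).div
      (hasDerivAt_gaussWeight y) hw).congr_deriv ?_
    simp only [E, g', g, id, Pi.mul_apply, Pi.pow_apply]
    field_simp
    ring
  have hid : ∀ a b : ℝ, ∫ y in a..b, E y =
      (∫ y in a..b, f y ^ 2 * gaussWeight y) + (T b - T a) / 2 := fun a b => by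
    have h1 : IntervalIntegrable E volume a b := hEc.intervalIntegrable _ _
    have h2 : IntervalIntegrable (fun y => f y ^ 2 * gaussWeight y) volume a b :=
      hf2.intervalIntegrable
    have h := intervalIntegral.integral_eq_sub_of_hasDerivAt (fun y (_ : y ∈ uIcc a b) => hT y)
      ((h1.sub h2).const_mul 2)
    rw [intervalIntegral.integral_const_mul, intervalIntegral.integral_sub h1 h2] at h
    linarith
  obtain ⟨htop, hbot⟩ := tendsto_sq_setIntegral_Iic hf hf2 h0
  have hlim : Tendsto (fun y : ℝ => ∫ x in (-y)..y, E x) atTop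
      (𝓝 (∫ y, f y ^ 2 * gaussWeight y)) := by
    have h := (intervalIntegral_tendsto_integral hf2 tendsto_neg_atTop_atBot tendsto_id).add
      ((htop.sub hbot).div_const 2)
    simp only [sub_zero, zero_div, add_zero] at h
    exact h.congr fun y => (hid (-y) y).symm
  have hEi : Integrable E := by
    refine integrable_of_intervalIntegral_norm_tendsto _
      (fun y => (hEc.integrableOn_Icc).mono_set Ioc_subset_Icc_self)
      tendsto_neg_atTop_atBot tendsto_id (hlim.congr fun y => ?_)
    simp only [Real.norm_eq_abs, abs_of_nonneg (hE0 _), id]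
  have hi' : Integrable fun y => g' y ^ 2 * gaussWeight y := by
    refine hEi.mono' (by fun_prop) (ae_of_all _ fun y => ?_)
    have := gaussWeight_pos y
    rw [Real.norm_of_nonneg (by positivity)]
    exact le_add_of_nonneg_right (by positivity)
  have hi : Integrable fun y => g y ^ 2 * gaussWeight y := by
    refine (hEi.const_mul 2).mono' (by fun_prop) (ae_of_all _ fun y => ?_)
    have := gaussWeight_pos y
    have h' : 0 ≤ g' y ^ 2 * gaussWeight y := by positivity
    rw [Real.norm_of_nonneg (by positivity)]
    simp only [E]
    linarith
  refine ⟨g, g', ⟨hg, hgc', hi, hi'⟩, fun y => by simp only [g']; ring, ?_⟩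
  rw [← integral_const_mul, ← integral_add hi' (hi.const_mul _)]
  exact tendsto_nhds_unique hlim
    (intervalIntegral_tendsto_integral hEi tendsto_neg_atTop_atBot tendsto_id)

/-- Functions orthogonal to all monomials of degree less than `k` satisfy the Gaussian Poincaré
inequality with constant `k / 2`. -/
theorem GaussSobolev.poincare (k : ℕ) : ∀ {f f' : ℝ → ℝ}, GaussSobolev f f' →
    (∀ j < k, ∫ y, y ^ j * f y * gaussWeight y = 0) →
    k / 2 * ∫ y, f y ^ 2 * gaussWeight y ≤ ∫ y, f' y ^ 2 * gaussWeight y := by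
  induction k with
  | zero =>
    intro f f' _ _
    simpa using integral_nonneg fun y => mul_nonneg (sq_nonneg (f' y)) (gaussWeight_pos y).le
  | succ k ih =>
    intro f f' hf horth
    obtain ⟨g, g', hg, hfg, hE⟩ := exists_gaussSobolev_adjoint_eq hf.continuous hf.integrable_sq
      (by simpa using horth 0 k.succ_pos)
    have hf2 := hf.integrable_sq
    simp only [hfg] at hf2
    have hgorth : ∀ j < k, ∫ y, y ^ j * g y * gaussWeight y = 0 := fun j hj => by
      have h := hg.integral_mul_adjoint (GaussSobolev.pow (j + 1)) hf2
      simp only [← hfg] at h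
      rw [horth (j + 1) (by lia)] at h
      simp only [Nat.add_sub_cancel, mul_assoc, integral_const_mul] at h
      have hj0 : ((j + 1 : ℕ) : ℝ) ≠ 0 := by positivity
      simpa only [mul_assoc] using (mul_eq_zero.1 h.symm).resolve_left hj0
    have hgap := ih hg hgorth
    have hA := hg.integral_mul_adjoint hf hf2
    simp only [← hfg, ← pow_two] at hA
    have hcs := sq_setIntegral_mul_gaussWeight_le univ hf.continuous_deriv hg.continuous
      hf.integrable_deriv_sq hg.integrable_sq
    simp only [Measure.restrict_univ, ← hA] at hcs
    have hA0 : 0 ≤ ∫ y, f y ^ 2 * gaussWeight y :=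
      integral_nonneg fun y => mul_nonneg (sq_nonneg _) (gaussWeight_pos y).le
    have hB0 : 0 ≤ ∫ y, f' y ^ 2 * gaussWeight y :=
      integral_nonneg fun y => mul_nonneg (sq_nonneg _) (gaussWeight_pos y).le
    generalize ∫ y, f y ^ 2 * gaussWeight y = A at *
    generalize ∫ y, f' y ^ 2 * gaussWeight y = B at *
    generalize ∫ y, g y ^ 2 * gaussWeight y = C at *
    generalize ∫ y, g' y ^ 2 * gaussWeight y = D at *
    push_cast
    have hC : ((k : ℝ) + 1) / 2 * C ≤ A := by linarith
    rcases hA0.eq_or_lt with h | h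
    · simpa [← h] using hB0
    · have hk : (0 : ℝ) ≤ (k + 1) / 2 := by positivity
      refine le_of_mul_le_mul_left ?_ h
      nlinarith [mul_le_mul_of_nonneg_left hcs hk, mul_le_mul_of_nonneg_left hC hB0]

/-- **Spectral gap** for `ℒ = ∂_y² - (y/2)∂_y + 1` in the Gaussian space `ℋ`:
any `C¹` function `f` with finite `𝔇`-norm that is orthogonal (in `ℋ`) to
`1`, `y` and `y² - 2` satisfies
`∫ f'(y)² e^{-y²/4} dy ≥ (3/2) ∫ f(y)² e^{-y²/4} dy`. -/
theorem spectral_gap (f : ℝ → ℝ) (hf : ContDiff ℝ 1 f)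
    (hfin : Integrable (fun y : ℝ => ((f y) ^ 2 + (deriv f y) ^ 2) * Real.exp (-y ^ 2 / 4)))
    (h0 : ∫ y : ℝ, f y * Real.exp (-y ^ 2 / 4) = 0)
    (h1 : ∫ y : ℝ, f y * y * Real.exp (-y ^ 2 / 4) = 0)
    (h2 : ∫ y : ℝ, f y * (y ^ 2 - 2) * Real.exp (-y ^ 2 / 4) = 0) :
    (3 / 2) * ∫ y : ℝ, (f y) ^ 2 * Real.exp (-y ^ 2 / 4) ≤
      ∫ y : ℝ, (deriv f y) ^ 2 * Real.exp (-y ^ 2 / 4) := by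
  have hc' : Continuous (deriv f) := hf.continuous_deriv le_rfl
  have hc : Continuous f := hf.continuous
  have hs : GaussSobolev f (deriv f) :=
    { hasDerivAt := fun y => (hf.differentiable one_ne_zero y).hasDerivAt
      continuous_deriv := hc'
      integrable_sq := by
        refine hfin.mono' (by fun_prop) (ae_of_all _ fun y => ?_)
        have := gaussWeight_pos y
        rw [Real.norm_of_nonneg (by positivity)]
        exact mul_le_mul_of_nonneg_right (le_add_of_nonneg_right (sq_nonneg _)) this.le
      integrable_deriv_sq := by
        refine hfin.mono' (by fun_prop) (ae_of_all _ fun y => ?_)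
        have := gaussWeight_pos y
        rw [Real.norm_of_nonneg (by positivity)]
        exact mul_le_mul_of_nonneg_right (le_add_of_nonneg_left (sq_nonneg _)) this.le }
  have hint : ∀ n : ℕ, Integrable fun y => y ^ n * f y * gaussWeight y := fun n =>
    integrable_mul_mul_gaussWeight (GaussSobolev.pow n).continuous hc
      (GaussSobolev.pow n).integrable_sq hs.integrable_sq
  have e0 : ∫ y, y ^ 0 * f y * gaussWeight y = 0 := by
    simpa only [pow_zero, one_mul, gaussWeight] using h0
  have e1 : ∫ y, y ^ 1 * f y * gaussWeight y = 0 := by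
    simpa only [pow_one, mul_comm (f _), gaussWeight] using h1
  have e2 : ∫ y, y ^ 2 * f y * gaussWeight y = 0 := by
    have e : ∫ y, (y ^ 2 * f y * gaussWeight y - 2 * (y ^ 0 * f y * gaussWeight y)) = 0 := by
      rw [← h2]
      congr 1
      ext y
      simp only [gaussWeight]
      ring
    rw [integral_sub (hint 2) ((hint 0).const_mul 2), integral_const_mul, e0] at e
    linarith
  have h := hs.poincare 3 fun j hj => by
    interval_cases j
    exacts [e0, e1, e2]
  exact_mod_cast h
end

section
/- Let n ≥ 2 be an integer, let Ω ⊆ ℝ² be open, and let U : Ω → (0,∞) be a smooth function satisfying ∂_t U = U_xx/(1+U_x²) - (n-1)/U on Ω. Set Q := U². Then at every point of Ω where ∂_x³ Q = 0 the following identity holds: ∂_t ∂_x² Q - (∂_x⁴ Q)/(1+U_x²) = -(1/(2Q)) · (Q_xx + 2) · (Q_xx - 2U_x²) · (Q_xx(1 - 3U_x²) - 8U_x²) / (1+U_x²)³, where Q_xx = ∂_x² Q. -/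
/-- `k`-th partial derivative in `x` of a function `U(x,t)`. -/
noncomputable def pdx (U : ℝ → ℝ → ℝ) (k : ℕ) (x t : ℝ) : ℝ :=
  deriv^[k] (fun x' => U x' t) x

/-- Partial derivative in `t` of a function `U(x,t)`. -/
noncomputable def pdt (U : ℝ → ℝ → ℝ) (x t : ℝ) : ℝ :=
  deriv (fun t' => U x t') t

open Function Topology

section PartialDerivatives

variable {V W : ℝ → ℝ → ℝ} {Ω : Set (ℝ × ℝ)}

lemma pdx_succ (V : ℝ → ℝ → ℝ) (k : ℕ) (x t : ℝ) :
    pdx V (k + 1) x t = deriv (fun y => pdx V k y t) x := by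
  simp only [pdx, iterate_succ_apply']

lemma hasDerivAt_slice_fst {x t : ℝ} (h : DifferentiableAt ℝ (uncurry V) (x, t)) :
    HasDerivAt (fun y => V y t) (fderiv ℝ (uncurry V) (x, t) (1, 0)) x := by
  have hl : HasDerivAt (fun y : ℝ => (y, t)) ((1 : ℝ), (0 : ℝ)) x :=
    (hasDerivAt_id x).prodMk (hasDerivAt_const x t)
  exact HasFDerivAt.comp_hasDerivAt x h.hasFDerivAt hl

lemma hasDerivAt_slice_snd {x t : ℝ} (h : DifferentiableAt ℝ (uncurry V) (x, t)) :
    HasDerivAt (fun s => V x s) (fderiv ℝ (uncurry V) (x, t) (0, 1)) t := by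
  have hl : HasDerivAt (fun s : ℝ => (x, s)) ((0 : ℝ), (1 : ℝ)) t :=
    (hasDerivAt_const t x).prodMk (hasDerivAt_id t)
  exact HasFDerivAt.comp_hasDerivAt t h.hasFDerivAt hl

lemma eventually_slice_fst_mem (hΩ : IsOpen Ω) {x t : ℝ} (h : (x, t) ∈ Ω) :
    ∀ᶠ y in 𝓝 x, (y, t) ∈ Ω :=
  (Continuous.prodMk_left t).continuousAt.eventually (hΩ.mem_nhds h)

lemma differentiableAt_of_contDiffOn (hΩ : IsOpen Ω)
    (hV : ContDiffOn ℝ (⊤ : ℕ∞) (uncurry V) Ω) {p : ℝ × ℝ} (hp : p ∈ Ω) :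
    DifferentiableAt ℝ (uncurry V) p :=
  (hV.contDiffAt (hΩ.mem_nhds hp)).differentiableAt (by simp)

lemma contDiffOn_fderiv_apply (hΩ : IsOpen Ω)
    (hV : ContDiffOn ℝ (⊤ : ℕ∞) (uncurry V) Ω) (v : ℝ × ℝ) :
    ContDiffOn ℝ (⊤ : ℕ∞) (fun p => fderiv ℝ (uncurry V) p v) Ω :=
  (hV.fderiv_of_isOpen hΩ (by simp)).clm_apply contDiffOn_const

lemma pdx_one_eq_fderiv (hΩ : IsOpen Ω) (hV : ContDiffOn ℝ (⊤ : ℕ∞) (uncurry V) Ω)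
    {p : ℝ × ℝ} (hp : p ∈ Ω) : pdx V 1 p.1 p.2 = fderiv ℝ (uncurry V) p (1, 0) :=
  (hasDerivAt_slice_fst (differentiableAt_of_contDiffOn hΩ hV hp)).deriv

lemma pdt_eq_fderiv (hΩ : IsOpen Ω) (hV : ContDiffOn ℝ (⊤ : ℕ∞) (uncurry V) Ω)
    {p : ℝ × ℝ} (hp : p ∈ Ω) : pdt V p.1 p.2 = fderiv ℝ (uncurry V) p (0, 1) :=
  (hasDerivAt_slice_snd (differentiableAt_of_contDiffOn hΩ hV hp)).deriv

lemma contDiffOn_pdx (hΩ : IsOpen Ω) (hV : ContDiffOn ℝ (⊤ : ℕ∞) (uncurry V) Ω) (k : ℕ) :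
    ContDiffOn ℝ (⊤ : ℕ∞) (uncurry (pdx V k)) Ω := by
  induction k with
  | zero => exact hV
  | succ k ih =>
    refine (contDiffOn_fderiv_apply hΩ ih (1, 0)).congr fun p hp => ?_
    rw [← pdx_one_eq_fderiv hΩ ih hp]
    exact pdx_succ V k p.1 p.2

lemma contDiffOn_pdt (hΩ : IsOpen Ω) (hV : ContDiffOn ℝ (⊤ : ℕ∞) (uncurry V) Ω) :
    ContDiffOn ℝ (⊤ : ℕ∞) (uncurry (pdt V)) Ω :=
  (contDiffOn_fderiv_apply hΩ hV (0, 1)).congr fun _ hp => pdt_eq_fderiv hΩ hV hp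

lemma hasDerivAt_pdx (hΩ : IsOpen Ω) (hV : ContDiffOn ℝ (⊤ : ℕ∞) (uncurry V) Ω) (k : ℕ)
    {x t : ℝ} (h : (x, t) ∈ Ω) :
    HasDerivAt (fun y => pdx V k y t) (pdx V (k + 1) x t) x := by
  rw [pdx_succ]
  exact (hasDerivAt_slice_fst (differentiableAt_of_contDiffOn hΩ
    (contDiffOn_pdx hΩ hV k) h)).differentiableAt.hasDerivAt

/-- The `x`-derivative of order `k + 1`, from a formula on `Ω` for the one of order `k`. -/
lemma pdx_succ_eq_of_hasDerivAt (hΩ : IsOpen Ω) {k : ℕ} {x t d : ℝ} (h : (x, t) ∈ Ω)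
    (heq : ∀ p ∈ Ω, pdx V k p.1 p.2 = W p.1 p.2) (hW : HasDerivAt (fun y => W y t) d x) :
    pdx V (k + 1) x t = d := by
  rw [pdx_succ]
  refine (hW.congr_of_eventuallyEq ?_).deriv
  filter_upwards [eventually_slice_fst_mem hΩ h] with y hy using heq _ hy

lemma pdx_succ_congr (hΩ : IsOpen Ω) {j k : ℕ}
    (heq : ∀ p ∈ Ω, pdx V j p.1 p.2 = pdx W k p.1 p.2) :
    ∀ p ∈ Ω, pdx V (j + 1) p.1 p.2 = pdx W (k + 1) p.1 p.2 := by
  intro p hp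
  rw [pdx_succ, pdx_succ]
  apply Filter.EventuallyEq.deriv_eq
  filter_upwards [eventually_slice_fst_mem hΩ hp] with y hy using heq _ hy

lemma pdt_pdx_one (hΩ : IsOpen Ω) (hV : ContDiffOn ℝ (⊤ : ℕ∞) (uncurry V) Ω) :
    ∀ p ∈ Ω, pdt (pdx V 1) p.1 p.2 = pdx (pdt V) 1 p.1 p.2 := by
  intro p hp
  have hd : DifferentiableAt ℝ (fderiv ℝ (uncurry V)) p :=
    ((hV.fderiv_of_isOpen hΩ (m := (⊤ : ℕ∞)) (by simp)).contDiffAt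
      (hΩ.mem_nhds hp)).differentiableAt (by simp)
  have hsymm : IsSymmSndFDerivAt ℝ (uncurry V) p :=
    (hV.contDiffAt (hΩ.mem_nhds hp)).isSymmSndFDerivAt
      (by
        rw [minSmoothness_of_isRCLikeNormedField]
        exact WithTop.coe_le_coe.2 (le_top : (2 : ℕ∞) ≤ ⊤))
  have happly (v w : ℝ × ℝ) : fderiv ℝ (fun q => fderiv ℝ (uncurry V) q v) p w =
      fderiv ℝ (fderiv ℝ (uncurry V)) p w v := by
    rw [fderiv_clm_apply hd (differentiableAt_const v)]
    simp
  rw [pdt_eq_fderiv hΩ (contDiffOn_pdx hΩ hV 1) hp,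
    pdx_one_eq_fderiv hΩ (contDiffOn_pdt hΩ hV) hp]
  have h1 : uncurry (pdx V 1) =ᶠ[𝓝 p] fun q => fderiv ℝ (uncurry V) q (1, 0) := by
    filter_upwards [hΩ.mem_nhds hp] with q hq using pdx_one_eq_fderiv hΩ hV hq
  have h2 : uncurry (pdt V) =ᶠ[𝓝 p] fun q => fderiv ℝ (uncurry V) q (0, 1) := by
    filter_upwards [hΩ.mem_nhds hp] with q hq using pdt_eq_fderiv hΩ hV hq
  rw [h1.fderiv_eq, h2.fderiv_eq, happly, happly]
  exact hsymm.eq _ _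

lemma pdt_pdx (hΩ : IsOpen Ω) (hV : ContDiffOn ℝ (⊤ : ℕ∞) (uncurry V) Ω) (k : ℕ) :
    ∀ p ∈ Ω, pdt (pdx V k) p.1 p.2 = pdx (pdt V) k p.1 p.2 := by
  induction k with
  | zero => exact fun p _ => rfl
  | succ k ih =>
    intro p hp
    have hk : pdx V (k + 1) = pdx (pdx V k) 1 := funext₂ fun x t => pdx_succ V k x t
    rw [hk, pdt_pdx_one hΩ (contDiffOn_pdx hΩ hV k) p hp]
    exact pdx_succ_congr hΩ (j := 0) (V := pdt (pdx V k)) ih p hp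

end PartialDerivatives

/-- If `U > 0` is smooth on an open set `Ω ⊆ ℝ²` and solves the rotationally
symmetric MCF profile equation `∂_t U = U_xx/(1+U_x²) - (n-1)/U`, then writing
`Q = U²`, at every point of `Ω` where `∂_x³ Q = 0` one has the identity
`∂_t∂_x²Q - (∂_x⁴Q)/(1+U_x²)
  = -(1/(2Q))·(Q_xx+2)·(Q_xx-2U_x²)·(Q_xx(1-3U_x²)-8U_x²)/(1+U_x²)³`. -/
theorem Qxx_evolution_identity (n : ℕ) (hn : 2 ≤ n)
    (Ω : Set (ℝ × ℝ)) (hΩ : IsOpen Ω) (U : ℝ → ℝ → ℝ)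
    (hU : ContDiffOn ℝ (⊤ : ℕ∞) (Function.uncurry U) Ω)
    (hpos : ∀ p ∈ Ω, 0 < U p.1 p.2)
    (hPDE : ∀ p ∈ Ω, pdt U p.1 p.2 =
      pdx U 2 p.1 p.2 / (1 + (pdx U 1 p.1 p.2) ^ 2) - ((n : ℝ) - 1) / U p.1 p.2) :
    ∀ p ∈ Ω, pdx (fun x t => (U x t) ^ 2) 3 p.1 p.2 = 0 →
      pdt (fun x t => pdx (fun a b => (U a b) ^ 2) 2 x t) p.1 p.2
          - pdx (fun x t => (U x t) ^ 2) 4 p.1 p.2 / (1 + (pdx U 1 p.1 p.2) ^ 2)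
        = -(1 / (2 * (U p.1 p.2) ^ 2))
            * (pdx (fun a b => (U a b) ^ 2) 2 p.1 p.2 + 2)
            * (pdx (fun a b => (U a b) ^ 2) 2 p.1 p.2 - 2 * (pdx U 1 p.1 p.2) ^ 2)
            * (pdx (fun a b => (U a b) ^ 2) 2 p.1 p.2 * (1 - 3 * (pdx U 1 p.1 p.2) ^ 2)
                - 8 * (pdx U 1 p.1 p.2) ^ 2)
            / (1 + (pdx U 1 p.1 p.2) ^ 2) ^ 3 := by
  rintro ⟨x, t⟩ hp
  dsimp only
  intro h3
  set Q : ℝ → ℝ → ℝ := fun a b => (U a b) ^ 2 with hQ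
  have hQs : ContDiffOn ℝ (⊤ : ℕ∞) (uncurry Q) Ω := hU.pow 2
  have hu (k : ℕ) {y s : ℝ} (h : (y, s) ∈ Ω) := hasDerivAt_pdx hΩ hU k h
  have hden (y s : ℝ) : 1 + (pdx U 1 y s) ^ 2 ≠ 0 := by positivity
  have hQ1 : ∀ p ∈ Ω, pdx Q 1 p.1 p.2 = 2 * pdx U 0 p.1 p.2 * pdx U 1 p.1 p.2 := by
    rintro ⟨y, s⟩ h
    refine pdx_succ_eq_of_hasDerivAt (W := fun a b => pdx U 0 a b ^ 2) hΩ h (fun _ _ => rfl) ?_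
    refine HasDerivAt.congr_deriv ((hu 0 h).pow 2) ?_
    simp
  have hQ2 : ∀ p ∈ Ω, pdx Q 2 p.1 p.2 =
      2 * pdx U 1 p.1 p.2 ^ 2 + 2 * pdx U 0 p.1 p.2 * pdx U 2 p.1 p.2 := by
    rintro ⟨y, s⟩ h
    refine pdx_succ_eq_of_hasDerivAt
      (W := fun a b => 2 * pdx U 0 a b * pdx U 1 a b) hΩ h hQ1 ?_
    refine HasDerivAt.congr_deriv (((hu 0 h).const_mul 2).mul (hu 1 h)) ?_
    ring
  have hQ3 : pdx Q 3 x t =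
      6 * pdx U 1 x t * pdx U 2 x t + 2 * pdx U 0 x t * pdx U 3 x t := by
    refine pdx_succ_eq_of_hasDerivAt
      (W := fun a b => 2 * pdx U 1 a b ^ 2 + 2 * pdx U 0 a b * pdx U 2 a b) hΩ hp hQ2 ?_
    refine HasDerivAt.congr_deriv ((((hu 1 hp).pow 2).const_mul 2).add
      (((hu 0 hp).const_mul 2).mul (hu 2 hp))) ?_
    simp only [Nat.cast_ofNat]
    ring
  have hQt : ∀ p ∈ Ω, pdt Q p.1 p.2 =
      (pdx Q 2 p.1 p.2 + 2) / (1 + pdx U 1 p.1 p.2 ^ 2) - 2 * n := by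
    rintro ⟨y, s⟩ h
    have hU0 : U y s ≠ 0 := (hpos _ h).ne'
    have hUt := (hasDerivAt_slice_snd
      (differentiableAt_of_contDiffOn hΩ hU h)).differentiableAt.hasDerivAt
    have hQt : pdt Q y s = 2 * U y s * pdt U y s := by
      refine HasDerivAt.deriv ?_
      refine HasDerivAt.congr_deriv (hUt.pow 2) ?_
      simp [pdt]
    have := hden y s
    rw [hQ2 _ h]
    dsimp only
    rw [hQt, hPDE _ h]
    change _ = (2 * pdx U 1 y s ^ 2 + 2 * U y s * pdx U 2 y s + 2) / _ - _
    field_simp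
    ring
  have hQt1 : ∀ p ∈ Ω, pdx (pdt Q) 1 p.1 p.2 =
      pdx Q 3 p.1 p.2 / (1 + pdx U 1 p.1 p.2 ^ 2)
        - 2 * (pdx Q 2 p.1 p.2 + 2) * pdx U 1 p.1 p.2 * pdx U 2 p.1 p.2
          / (1 + pdx U 1 p.1 p.2 ^ 2) ^ 2 := by
    rintro ⟨y, s⟩ h
    refine pdx_succ_eq_of_hasDerivAt (k := 0) hΩ h hQt
      (W := fun a b => (pdx Q 2 a b + 2) / (1 + pdx U 1 a b ^ 2) - 2 * n) ?_
    refine HasDerivAt.congr_deriv ((((hasDerivAt_pdx hΩ hQs 2 h).add_const 2).div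
      (((hu 1 h).pow 2).const_add 1) (hden y s)).sub_const (2 * (n : ℝ))) ?_
    have := hden y s
    simp only [Nat.cast_ofNat, Pi.pow_apply]
    field_simp
    ring
  have hQt2 : pdx (pdt Q) 2 x t =
      pdx Q 4 x t / (1 + pdx U 1 x t ^ 2)
        - 4 * pdx Q 3 x t * pdx U 1 x t * pdx U 2 x t / (1 + pdx U 1 x t ^ 2) ^ 2
        - 2 * (pdx Q 2 x t + 2) * (pdx U 2 x t ^ 2 + pdx U 1 x t * pdx U 3 x t)
          / (1 + pdx U 1 x t ^ 2) ^ 2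
        + 8 * (pdx Q 2 x t + 2) * pdx U 1 x t ^ 2 * pdx U 2 x t ^ 2
          / (1 + pdx U 1 x t ^ 2) ^ 3 := by
    refine pdx_succ_eq_of_hasDerivAt hΩ hp hQt1
      (W := fun a b => pdx Q 3 a b / (1 + pdx U 1 a b ^ 2)
        - 2 * (pdx Q 2 a b + 2) * pdx U 1 a b * pdx U 2 a b / (1 + pdx U 1 a b ^ 2) ^ 2) ?_
    have hd := ((hu 1 hp).pow 2).const_add 1
    refine HasDerivAt.congr_deriv (((hasDerivAt_pdx hΩ hQs 3 hp).div hd (hden x t)).sub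
      ((((((hasDerivAt_pdx hΩ hQs 2 hp).add_const 2).const_mul 2).mul (hu 1 hp)).mul
        (hu 2 hp)).div (hd.pow 2) (pow_ne_zero 2 (hden x t)))) ?_
    have := hden x t
    simp only [Nat.cast_ofNat, Pi.pow_apply, Pi.mul_apply]
    field_simp
    ring
  have hcomm : pdt (fun x t => pdx Q 2 x t) x t = pdx (pdt Q) 2 x t := pdt_pdx hΩ hQs 2 _ hp
  have hU0 : U x t ≠ 0 := (hpos _ hp).ne'
  have hU3 : pdx U 3 x t = -3 * pdx U 1 x t * pdx U 2 x t / U x t := by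
    have h0 : 6 * pdx U 1 x t * pdx U 2 x t + 2 * U x t * pdx U 3 x t = 0 := hQ3.symm.trans h3
    field_simp
    linarith
  have hQ2x : pdx Q 2 x t = 2 * pdx U 1 x t ^ 2 + 2 * U x t * pdx U 2 x t := hQ2 _ hp
  have := hden x t
  rw [hcomm, hQt2, h3, hU3, hQ2x]
  field_simp
  ring
end

section
/- Let n ≥ 2 be an integer, let ε > 0, and let Z : [0,ε) → ℝ be a C² function with Z(0) = 0 and Z'(0) = 0 that satisfies the Bowl-soliton ODE Z''(ρ)/(1+Z'(ρ)²) + ((n-1)/ρ)·Z'(ρ) + √2/2 = 0 for all ρ ∈ (0,ε). Then Z''(0) = -√2/(2n). -/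
/-- A `C²` solution `Z` of the Bowl-soliton ODE
`Z''/(1+Z'²) + ((n-1)/ρ)Z' + √2/2 = 0` on `(0,ε)` with `Z(0) = 0`, `Z'(0) = 0`
has `Z''(0) = -√2/(2n)`.  Derivatives are one-sided derivatives within `[0,ε)`. -/
theorem bowl_soliton_second_deriv_at_tip (n : ℕ) (hn : 2 ≤ n) (ε : ℝ) (hε : 0 < ε)
    (Z : ℝ → ℝ) (hZ : ContDiffOn ℝ 2 Z (Set.Ico 0 ε))
    (hZ0 : Z 0 = 0)
    (hZ'0 : derivWithin Z (Set.Ico 0 ε) 0 = 0)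
    (hODE : ∀ ρ ∈ Set.Ioo (0 : ℝ) ε,
      derivWithin (derivWithin Z (Set.Ico 0 ε)) (Set.Ico 0 ε) ρ
          / (1 + (derivWithin Z (Set.Ico 0 ε) ρ) ^ 2)
        + ((n : ℝ) - 1) / ρ * derivWithin Z (Set.Ico 0 ε) ρ
        + Real.sqrt 2 / 2 = 0) :
    derivWithin (derivWithin Z (Set.Ico 0 ε)) (Set.Ico 0 ε) 0 =
      -(Real.sqrt 2 / (2 * (n : ℝ))) := by
  set f := derivWithin Z (Set.Ico 0 ε)
  set g := derivWithin f (Set.Ico 0 ε)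
  have hu : UniqueDiffOn ℝ (Set.Ico 0 ε) := uniqueDiffOn_Ico 0 ε
  have h0 : (0 : ℝ) ∈ Set.Ico 0 ε := ⟨le_rfl, hε⟩
  have hf : ContDiffOn ℝ 1 f (Set.Ico 0 ε) := hZ.derivWithin hu (by norm_num)
  have hg : ContinuousOn g (Set.Ico 0 ε) := hf.continuousOn_derivWithin hu le_rfl
  have hf_diff : HasDerivWithinAt f (g 0) (Set.Ico 0 ε) 0 :=
    (hf.differentiableOn one_ne_zero 0 h0).hasDerivWithinAt
  have hsub : Set.Ioo 0 ε ⊆ Set.Ico 0 ε := Set.Ioo_subset_Ico_self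
  have hf_tendsto : Filter.Tendsto f (nhdsWithin 0 (Set.Ioo 0 ε)) (nhds 0) := by
    simpa only [ContinuousWithinAt, hZ'0] using (hf.continuousOn 0 h0).mono hsub
  have hg_tendsto : Filter.Tendsto g (nhdsWithin 0 (Set.Ioo 0 ε)) (nhds (g 0)) :=
    (hg 0 h0).mono hsub
  have hslope : Filter.Tendsto (slope f 0) (nhdsWithin 0 (Set.Ioo 0 ε)) (nhds (g 0)) := by
    simpa only [Set.Ico_sdiff_left] using hasDerivWithinAt_iff_tendsto_slope.1 hf_diff
  have hlim : Filter.Tendsto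
      (fun ρ => g ρ / (1 + f ρ ^ 2) + ((n : ℝ) - 1) * slope f 0 ρ + Real.sqrt 2 / 2)
      (nhdsWithin 0 (Set.Ioo 0 ε))
      (nhds (g 0 / (1 + 0 ^ 2) + ((n : ℝ) - 1) * g 0 + Real.sqrt 2 / 2)) :=
    ((hg_tendsto.div ((hf_tendsto.pow 2).const_add 1) (by norm_num)).add
      (hslope.const_mul _)).add_const _
  have hzero : (fun ρ => g ρ / (1 + f ρ ^ 2) + ((n : ℝ) - 1) * slope f 0 ρ + Real.sqrt 2 / 2)
      =ᶠ[nhdsWithin 0 (Set.Ioo 0 ε)] fun _ => 0 := by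
    filter_upwards [self_mem_nhdsWithin] with ρ hρ
    rw [slope_def_field, hZ'0]
    refine Eq.trans ?_ (hODE ρ hρ)
    ring
  have : (nhdsWithin 0 (Set.Ioo 0 ε)).NeBot := left_nhdsWithin_Ioo_neBot hε
  have key := tendsto_nhds_unique (hlim.congr' hzero) tendsto_const_nhds
  have hn' : (n : ℝ) ≠ 0 := by positivity
  field_simp
  linarith
end

section
/- Let n ≥ 2 be an integer, let ε > 0, and let Z : [0,ε) → ℝ be a C⁴ function with Z(0) = 0 and Z'(0) = 0 that satisfies the Bowl-soliton ODE Z''(ρ)/(1+Z'(ρ)²) + ((n-1)/ρ)·Z'(ρ) + √2/2 = 0 for all ρ ∈ (0,ε). Then there exists δ ∈ (0,ε) such that for all ρ ∈ (0,δ): Z'(ρ) ≠ 0 and 2·(Z'(ρ) - ρ·Z''(ρ))/Z'(ρ)³ ≤ -1/(n+2). -/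
open Filter Topology Set

section RadialODE

variable {n : ℕ} {ε c a : ℝ} {p q : ℝ → ℝ}

/-- The radial ODE `q / (1 + p²) + (n - 1) p / ρ + c = 0` solved for `q`. -/
theorem radial_ode_solved {ρ P Q k : ℝ} (h : Q / (1 + P ^ 2) + k / ρ * P + c = 0) :
    Q = -((1 + P ^ 2) * (c + k * (P / ρ))) := by
  have h1 : (1 + P ^ 2) ≠ 0 := by positivity
  have h2 : Q / (1 + P ^ 2) = -(c + k * (P / ρ)) := by
    rw [div_mul_eq_mul_div, mul_div_assoc] at h
    linarith
  rw [div_eq_iff h1] at h2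
  linarith

/-- The slope at the origin of a solution of the radial ODE. -/
theorem radial_ode_slope_zero
    (hode : ∀ᶠ ρ in 𝓝[>] (0 : ℝ), q ρ = -((1 + p ρ ^ 2) * (c + ((n : ℝ) - 1) * (p ρ / ρ))))
    (hp0 : Tendsto p (𝓝[>] 0) (𝓝 0)) (hslope : Tendsto (fun ρ => p ρ / ρ) (𝓝[>] 0) (𝓝 a))
    (hq : Tendsto q (𝓝[>] 0) (𝓝 a)) : c = -(n * a) := by
  have h : Tendsto q (𝓝[>] 0) (𝓝 (-((1 + (0 : ℝ) ^ 2) * (c + ((n : ℝ) - 1) * a)))) :=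
    (((hp0.pow 2).const_add 1).mul ((hslope.const_mul _).const_add c)).neg.congr'
      (hode.mono fun _ h => h.symm)
  have := tendsto_nhds_unique hq h
  linarith

/-- The cubic Taylor coefficient at the origin of a solution of the radial ODE. -/
theorem tendsto_radial_ode_cubic (hn : 2 ≤ n) (hc : c = -(n * a))
    (hderiv : ∀ᶠ ρ in 𝓝[>] (0 : ℝ), HasDerivAt p (q ρ) ρ)
    (hode : ∀ᶠ ρ in 𝓝[>] (0 : ℝ), q ρ = -((1 + p ρ ^ 2) * (c + ((n : ℝ) - 1) * (p ρ / ρ))))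
    (hp0 : Tendsto p (𝓝[>] 0) (𝓝 0)) (hslope : Tendsto (fun ρ => p ρ / ρ) (𝓝[>] 0) (𝓝 a)) :
    Tendsto (fun ρ => (n * p ρ + c * ρ) / ρ ^ 3) (𝓝[>] 0) (𝓝 (n * a ^ 3 / (n + 2))) := by
  obtain ⟨m, rfl⟩ : ∃ m, n = m + 2 := ⟨n - 2, by omega⟩
  push_cast at *
  have hpos : ∀ᶠ ρ in 𝓝[>] (0 : ℝ), 0 < ρ := eventually_mem_nhdsWithin
  have hid : Tendsto (fun ρ : ℝ => ρ) (𝓝[>] 0) (𝓝 0) := tendsto_id.mono_left nhdsWithin_le_nhds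
  have key : Tendsto (fun ρ => ρ ^ (m + 1) * (((m : ℝ) + 2) * p ρ + c * ρ) / ρ ^ (m + 4))
      (𝓝[>] 0) (𝓝 (((m : ℝ) + 2) * a ^ 3 / (m + 2 + 2))) := by
    refine HasDerivAt.lhopital_zero_nhdsGT
      (f' := fun ρ => ((m + 1 : ℕ) : ℝ) * ρ ^ m * (((m : ℝ) + 2) * p ρ + c * ρ)
        + ρ ^ (m + 1) * (((m : ℝ) + 2) * q ρ + c * 1))
      (g' := fun ρ => ((m + 4 : ℕ) : ℝ) * ρ ^ (m + 3)) ?_ ?_ ?_ ?_ ?_ ?_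
    · filter_upwards [hderiv] with ρ h
      exact (hasDerivAt_pow (m + 1) ρ).mul
        ((h.const_mul ((m : ℝ) + 2)).add ((hasDerivAt_id ρ).const_mul c))
    · exact Eventually.of_forall fun ρ => hasDerivAt_pow (m + 4) ρ
    · filter_upwards [hpos] with ρ h
      positivity
    · simpa using (hid.pow (m + 1)).mul ((hp0.const_mul ((m : ℝ) + 2)).add (hid.const_mul c))
    · simpa using hid.pow (m + 4)
    · have hlim : Tendsto (fun ρ => -(((m : ℝ) + 2) / (m + 4)) * ((p ρ / ρ) ^ 2 *
          (c + ((m : ℝ) + 2 - 1) * (p ρ / ρ)))) (𝓝[>] 0)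
          (𝓝 (-(((m : ℝ) + 2) / (m + 4)) * (a ^ 2 * (c + ((m : ℝ) + 2 - 1) * a)))) :=
        ((hslope.pow 2).mul ((hslope.const_mul _).const_add c)).const_mul _
      have hval : -(((m : ℝ) + 2) / (m + 4)) * (a ^ 2 * (c + ((m : ℝ) + 2 - 1) * a))
          = ((m : ℝ) + 2) * a ^ 3 / (m + 2 + 2) := by
        rw [hc]
        have h4 : (m : ℝ) + 4 ≠ 0 := by positivity
        have h5 : (m : ℝ) + 2 + 2 ≠ 0 := by positivity
        field_simp
        ring
      rw [hval] at hlim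
      refine hlim.congr' ?_
      filter_upwards [hpos, hode] with ρ h ho
      rw [ho]
      have h4 : (m : ℝ) + 4 ≠ 0 := by positivity
      push_cast
      field_simp
      ring
  refine key.congr' ?_
  filter_upwards [hpos] with ρ h
  field_simp
  ring

/-- The limit at the origin of `2 (p - ρ q) / p³` for a solution of the radial ODE. -/
theorem tendsto_radial_ode_ratio (hn : 2 ≤ n) (ha : a ≠ 0) (hc : c = -(n * a))
    (hderiv : ∀ᶠ ρ in 𝓝[>] (0 : ℝ), HasDerivAt p (q ρ) ρ)
    (hode : ∀ᶠ ρ in 𝓝[>] (0 : ℝ), q ρ = -((1 + p ρ ^ 2) * (c + ((n : ℝ) - 1) * (p ρ / ρ))))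
    (hp0 : Tendsto p (𝓝[>] 0) (𝓝 0)) (hslope : Tendsto (fun ρ => p ρ / ρ) (𝓝[>] 0) (𝓝 a)) :
    Tendsto (fun ρ => 2 * (p ρ - ρ * q ρ) / p ρ ^ 3) (𝓝[>] 0) (𝓝 (-(4 / ((n : ℝ) + 2)))) := by
  have hpos : ∀ᶠ ρ in 𝓝[>] (0 : ℝ), 0 < ρ := eventually_mem_nhdsWithin
  have hlim := (((tendsto_radial_ode_cubic hn hc hderiv hode hp0 hslope).add
    ((hslope.pow 2).mul ((hslope.const_mul ((n : ℝ) - 1)).const_add c))).const_mul 2).div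
      (hslope.pow 3) (pow_ne_zero 3 ha)
  have hval : 2 * ((n : ℝ) * a ^ 3 / (n + 2) + a ^ 2 * (c + ((n : ℝ) - 1) * a)) / a ^ 3
      = -(4 / ((n : ℝ) + 2)) := by
    rw [hc]
    field_simp
    ring
  rw [hval] at hlim
  refine hlim.congr' ?_
  filter_upwards [hpos, hode] with ρ h ho
  rw [ho]
  simp only [Pi.div_apply]
  field_simp
  ring

end RadialODE

/-- Near the tip of the Bowl soliton the square of the profile is strictly
concave: if `Z` is a `C⁴` solution of the Bowl-soliton ODE
`Z''/(1+Z'²) + ((n-1)/ρ)Z' + √2/2 = 0` on `(0,ε)` with `Z(0) = 0`, `Z'(0) = 0`,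
then there is `δ ∈ (0,ε)` such that for all `ρ ∈ (0,δ)` one has `Z'(ρ) ≠ 0` and
`2(Z'(ρ) - ρ Z''(ρ))/Z'(ρ)³ ≤ -1/(n+2)`.
Derivatives are one-sided derivatives within `[0,ε)`. -/
theorem bowl_soliton_qyy_negative_near_tip (n : ℕ) (hn : 2 ≤ n) (ε : ℝ) (hε : 0 < ε)
    (Z : ℝ → ℝ) (hZ : ContDiffOn ℝ 4 Z (Set.Ico 0 ε))
    (hZ0 : Z 0 = 0)
    (hZ'0 : derivWithin Z (Set.Ico 0 ε) 0 = 0)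
    (hODE : ∀ ρ ∈ Set.Ioo (0 : ℝ) ε,
      derivWithin (derivWithin Z (Set.Ico 0 ε)) (Set.Ico 0 ε) ρ
          / (1 + (derivWithin Z (Set.Ico 0 ε) ρ) ^ 2)
        + ((n : ℝ) - 1) / ρ * derivWithin Z (Set.Ico 0 ε) ρ
        + Real.sqrt 2 / 2 = 0) :
    ∃ δ : ℝ, 0 < δ ∧ δ < ε ∧ ∀ ρ ∈ Set.Ioo (0 : ℝ) δ,
      derivWithin Z (Set.Ico 0 ε) ρ ≠ 0 ∧
      2 * (derivWithin Z (Set.Ico 0 ε) ρ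
            - ρ * derivWithin (derivWithin Z (Set.Ico 0 ε)) (Set.Ico 0 ε) ρ)
          / (derivWithin Z (Set.Ico 0 ε) ρ) ^ 3 ≤ -(1 / ((n : ℝ) + 2)) := by
  set S := Ico (0 : ℝ) ε with hS
  set p := derivWithin Z S with hp
  set q := derivWithin p S with hq
  have hu : UniqueDiffOn ℝ S := uniqueDiffOn_Ico 0 ε
  have h0 : (0 : ℝ) ∈ S := ⟨le_rfl, hε⟩
  have hpC : ContDiffOn ℝ 3 p S := hZ.derivWithin hu (by norm_num)
  have hqC : ContDiffOn ℝ 2 q S := hpC.derivWithin hu (by norm_num)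
  have hpd : DifferentiableOn ℝ p S := hpC.differentiableOn (by norm_num)
  have hIoo : ∀ᶠ ρ in 𝓝[>] (0 : ℝ), ρ ∈ Ioo (0 : ℝ) ε := Ioo_mem_nhdsGT hε
  have hle : 𝓝[>] (0 : ℝ) ≤ 𝓝[S] 0 := by
    rw [← nhdsWithin_Ioo_eq_nhdsGT hε]
    exact nhdsWithin_mono _ Ioo_subset_Ico_self
  have hp0 : Tendsto p (𝓝[>] 0) (𝓝 0) := by
    simpa only [ContinuousWithinAt, hZ'0] using (hpC.continuousOn 0 h0).mono_left hle
  have hq0 : Tendsto q (𝓝[>] 0) (𝓝 (q 0)) := (hqC.continuousOn 0 h0).mono_left hle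
  have hslope : Tendsto (fun ρ => p ρ / ρ) (𝓝[>] 0) (𝓝 (q 0)) := by
    have h := hasDerivWithinAt_iff_tendsto_slope.1 (hpd 0 h0).hasDerivWithinAt
    rw [hS, Ico_sdiff_left, nhdsWithin_Ioo_eq_nhdsGT hε] at h
    refine h.congr fun ρ => ?_
    rw [slope_def_field, hZ'0, sub_zero, sub_zero]
  have hderiv : ∀ᶠ ρ in 𝓝[>] (0 : ℝ), HasDerivAt p (q ρ) ρ := by
    filter_upwards [hIoo] with ρ hρ
    exact (hpd ρ (Ioo_subset_Ico_self hρ)).hasDerivWithinAt.hasDerivAt (Ico_mem_nhds hρ.1 hρ.2)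
  have hode : ∀ᶠ ρ in 𝓝[>] (0 : ℝ),
      q ρ = -((1 + p ρ ^ 2) * (Real.sqrt 2 / 2 + ((n : ℝ) - 1) * (p ρ / ρ))) := by
    filter_upwards [hIoo] with ρ hρ
    exact radial_ode_solved (hODE ρ hρ)
  have hc := radial_ode_slope_zero hode hp0 hslope hq0
  have ha : q 0 ≠ 0 := by
    intro h
    have : 0 < Real.sqrt 2 / 2 := by positivity
    rw [hc, h] at this
    simp at this
  have hratio := tendsto_radial_ode_ratio hn ha hc hderiv hode hp0 hslope
  have hlt : -(4 / ((n : ℝ) + 2)) < -(1 / ((n : ℝ) + 2)) := by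
    gcongr
    norm_num
  have hev : ∀ᶠ ρ in 𝓝[>] (0 : ℝ),
      p ρ ≠ 0 ∧ 2 * (p ρ - ρ * q ρ) / p ρ ^ 3 ≤ -(1 / ((n : ℝ) + 2)) := by
    filter_upwards [hslope.eventually_ne ha, hratio.eventually_le_const hlt] with ρ h1 h2
    exact ⟨fun h => h1 (by rw [h, zero_div]), h2⟩
  obtain ⟨u, hu0, hu⟩ := mem_nhdsGT_iff_exists_Ioo_subset.1 hev
  refine ⟨min u (ε / 2), lt_min hu0 (half_pos hε), (min_le_right _ _).trans_lt (half_lt_self hε),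
    fun ρ hρ => hu ⟨hρ.1, hρ.2.trans_le (min_le_left _ _)⟩⟩
end

section
/- Let n ≥ 2 be an integer and let Z : [0,∞) → ℝ be a smooth function with Z(0) = 0, Z'(0) = 0, Z'(ρ) < 0 and Z''(ρ) < 0 for every ρ > 0, satisfying the Bowl-soliton ODE Z''(ρ)/(1+Z'(ρ)²) + ((n-1)/ρ)·Z'(ρ) + √2/2 = 0 for all ρ > 0. Assume moreover that there exists ℓ₀ > 0 such that Z'(ρ) - ρ·Z''(ρ) > 0 for all ρ ≥ ℓ₀. Then Z'(ρ) - ρ·Z''(ρ) > 0 for every ρ > 0; equivalently, 2·(Z'(ρ) - ρ·Z''(ρ))/Z'(ρ)³ < 0 for every ρ > 0. -/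
open Set Filter Topology in
/-- A `C¹` solution on `[0, ∞)` of `p' = -(1 + p²)(c + m p/ρ)` with `p 0 = 0` satisfies
`p ρ / ρ → -c / (m + 1)` as `ρ → 0⁺`. -/
lemma tendsto_slope_zero_of_soliton_ode {p : ℝ → ℝ} {c m : ℝ} (hm : 0 < m + 1)
    (hp : ContDiffOn ℝ 1 p (Ici 0)) (hp0 : p 0 = 0)
    (hode : ∀ ρ > (0 : ℝ), HasDerivAt p (-(1 + p ρ ^ 2) * (c + m * (p ρ / ρ))) ρ) :
    Tendsto (fun ρ => p ρ / ρ) (𝓝[>] 0) (𝓝 (-c / (m + 1))) := by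
  set L := derivWithin p (Ici 0) 0
  have hu : UniqueDiffOn ℝ (Ici (0 : ℝ)) := uniqueDiffOn_Ici 0
  have hmem : (0 : ℝ) ∈ Ici (0 : ℝ) := self_mem_Ici
  have hle : 𝓝[>] (0 : ℝ) ≤ 𝓝[≥] 0 := nhdsWithin_mono _ Ioi_subset_Ici_self
  have hslope : Tendsto (fun ρ => p ρ / ρ) (𝓝[>] 0) (𝓝 L) := by
    have h := ((hp.differentiableOn one_ne_zero) 0 hmem).hasDerivWithinAt
    rw [hasDerivWithinAt_iff_tendsto_slope] at h
    simpa [slope_fun_def_field, hp0] using h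
  have hp_lim : Tendsto p (𝓝[>] 0) (𝓝 0) := by
    have h := (hp.continuousOn 0 hmem).tendsto
    rw [hp0] at h
    exact h.mono_left hle
  have hderiv : Tendsto (derivWithin p (Ici 0)) (𝓝[>] 0) (𝓝 L) :=
    ((hp.continuousOn_derivWithin hu le_rfl) 0 hmem).tendsto.mono_left hle
  have hrhs : Tendsto (fun ρ => -(1 + p ρ ^ 2) * (c + m * (p ρ / ρ))) (𝓝[>] 0)
      (𝓝 (-(1 + 0 ^ 2) * (c + m * L))) :=
    ((hp_lim.pow 2).const_add 1).neg.mul ((hslope.const_mul m).const_add c)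
  have heq : L = -(1 + 0 ^ 2) * (c + m * L) := by
    refine tendsto_nhds_unique hderiv (hrhs.congr' ?_)
    filter_upwards [self_mem_nhdsWithin] with ρ hρ
    exact ((hode ρ hρ).hasDerivWithinAt.derivWithin (hu ρ (Ioi_subset_Ici_self hρ))).symm
  have hL : L = -c / (m + 1) := by
    rw [eq_div_iff hm.ne']
    linarith
  exact hL ▸ hslope

open Set Filter Topology in
/-- For a negative, decreasing solution of `p' = -(1 + p²)(c + m p/ρ)` whose slope `p ρ / ρ` has
the limit `-c / (m + 1)` at `0⁺`, the slope is strictly decreasing, in the form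
`p/ρ - p' > 0`. -/
lemma soliton_ode_slope_sub_deriv_pos {p : ℝ → ℝ} {c m : ℝ} (hm : 0 < m + 1)
    (hode : ∀ ρ > (0 : ℝ), HasDerivAt p (-(1 + p ρ ^ 2) * (c + m * (p ρ / ρ))) ρ)
    (hneg : ∀ ρ > (0 : ℝ), p ρ < 0) (hpos : ∀ ρ > (0 : ℝ), 0 < c + m * (p ρ / ρ))
    (hlim : Tendsto (fun ρ => p ρ / ρ) (𝓝[>] 0) (𝓝 (-c / (m + 1)))) {ρ : ℝ} (hρ : 0 < ρ) :
    0 < p ρ / ρ + (1 + p ρ ^ 2) * (c + m * (p ρ / ρ)) := by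
  set G : ℝ → ℝ := fun ρ => p ρ / ρ + (1 + p ρ ^ 2) * (c + m * (p ρ / ρ)) with hG
  have hw : ∀ r > (0 : ℝ), HasDerivAt (fun ρ => p ρ / ρ) (-G r / r) r := by
    intro r hr
    have hr' := hr.ne'
    refine ((hode r hr).div (hasDerivAt_id r) hr').congr_deriv ?_
    simp only [hG, id]
    field_simp
    ring
  -- Wherever `G` vanishes, it crosses zero upwards.
  have hG' : ∀ r > (0 : ℝ), ∃ g, HasDerivAt G g r ∧ (G r = 0 → 0 < g) := by
    intro r hr
    refine ⟨_, (hw r hr).add ((((hode r hr).pow 2).const_add 1).mul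
      (((hw r hr).const_mul m).const_add c)), fun h0 => ?_⟩
    have hd : -(1 + p r ^ 2) * (c + m * (p r / r)) = p r / r := by
      simp only [hG] at h0
      linarith
    have h1 : 0 < p r * (p r / r) :=
      mul_pos_of_neg_of_neg (hneg r hr) (div_neg_of_neg_of_pos (hneg r hr) hr)
    have h2 := mul_pos h1 (hpos r hr)
    simp only [h0, hd]
    norm_num
    linarith
  have hstay : ∀ a b : ℝ, 0 < a → a ≤ b → 0 ≤ G a → 0 ≤ G b := by
    intro a b ha hab hGa
    choose! g hg hg0 using hG'
    have hc : ContinuousOn (fun r => -G r) (Icc a b) := fun r hr =>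
      (hg r (ha.trans_le hr.1)).continuousAt.neg.continuousWithinAt
    have h := image_le_of_deriv_right_lt_deriv_boundary' (f := fun r => -G r)
      (f' := fun r => -g r) (B := fun _ => 0) (B' := fun _ => 0) hc
      (fun r hr => (hg r (ha.trans_le hr.1)).neg.hasDerivWithinAt) (by simpa using hGa)
      continuousOn_const (fun r _ => hasDerivWithinAt_const _ _ _)
      (fun r hr h0 => by
        have := hg0 r (ha.trans_le hr.1) (by simpa using h0)
        linarith)
      (right_mem_Icc.2 hab)
    simpa using h
  by_contra hle
  have hle : G ρ ≤ 0 := not_lt.1 hle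
  obtain ⟨b, hb, hGb⟩ : ∃ b > 0, G b < 0 := by
    rcases hle.lt_or_eq with h | h
    · exact ⟨ρ, hρ, h⟩
    obtain ⟨g, hg, hg0⟩ := hG' ρ hρ
    have hev := eventually_nhdsWithin_sign_eq_of_deriv_pos (hg.deriv.symm ▸ hg0 h) h
    have hev' : ∀ᶠ x in 𝓝[<] ρ, SignType.sign (G x) = SignType.sign (x - ρ) :=
      hev.filter_mono nhdsWithin_le_nhds
    obtain ⟨x, hx, hx0, hxρ⟩ := (hev'.and (Ioo_mem_nhdsLT hρ)).exists
    rw [sign_neg (sub_neg.2 hxρ), sign_eq_neg_one_iff] at hx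
    exact ⟨x, hx0, hx⟩
  have hGneg : ∀ r, 0 < r → r ≤ b → G r < 0 := fun r hr hrb =>
    lt_of_not_ge fun h => (hstay r b hr hrb h).not_gt hGb
  have hmono : MonotoneOn (fun ρ => p ρ / ρ) (Ioc 0 b) := by
    refine monotoneOn_of_deriv_nonneg (convex_Ioc 0 b)
      (fun r hr => (hw r hr.1).continuousAt.continuousWithinAt)
      (fun r hr => (hw r (interior_subset hr).1).differentiableAt.differentiableWithinAt) ?_
    intro r hr
    have hr := interior_subset hr
    rw [(hw r hr.1).deriv]
    exact div_nonneg (neg_nonneg.2 (hGneg r hr.1 hr.2).le) hr.1.le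
  have hlim_le : -c / (m + 1) ≤ p b / b := by
    refine le_of_tendsto hlim ?_
    filter_upwards [Ioc_mem_nhdsGT hb] with r hr
    exact hmono hr ⟨hb, le_rfl⟩ hr.2
  rw [div_le_iff₀ hm] at hlim_le
  have h3 := mul_nonneg (sq_nonneg (p b)) (hpos b hb).le
  simp only [hG] at hGb
  linarith

/-- On the Bowl soliton the quantity `(u²)_yy = 2(Z' - ρZ'')/Z'³` is negative
everywhere: let `Z` be smooth on `[0,∞)` with `Z(0) = 0`, `Z'(0) = 0`,
`Z' < 0` and `Z'' < 0` on `(0,∞)`, solving the Bowl-soliton ODE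
`Z''/(1+Z'²) + ((n-1)/ρ)Z' + √2/2 = 0` on `(0,∞)`, and suppose that
`Z' - ρZ'' > 0` for all large `ρ` (the known quadratic asymptotics).
Then `Z'(ρ) - ρZ''(ρ) > 0`, i.e. `2(Z'(ρ) - ρZ''(ρ))/Z'(ρ)³ < 0`, for all `ρ > 0`. -/
theorem bowl_soliton_qyy_negative_everywhere (n : ℕ) (hn : 2 ≤ n) (Z : ℝ → ℝ)
    (hZ : ContDiffOn ℝ (⊤ : ℕ∞) Z (Set.Ici 0))
    (hZ0 : Z 0 = 0)
    (hZ'0 : derivWithin Z (Set.Ici 0) 0 = 0)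
    (hZ' : ∀ ρ > (0 : ℝ), deriv Z ρ < 0)
    (hZ'' : ∀ ρ > (0 : ℝ), deriv (deriv Z) ρ < 0)
    (hODE : ∀ ρ > (0 : ℝ),
      deriv (deriv Z) ρ / (1 + (deriv Z ρ) ^ 2)
        + ((n : ℝ) - 1) / ρ * deriv Z ρ + Real.sqrt 2 / 2 = 0)
    (hfar : ∃ ℓ₀ > (0 : ℝ), ∀ ρ ≥ ℓ₀, 0 < deriv Z ρ - ρ * deriv (deriv Z) ρ) :
    ∀ ρ > (0 : ℝ), 0 < deriv Z ρ - ρ * deriv (deriv Z) ρ ∧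
      2 * (deriv Z ρ - ρ * deriv (deriv Z) ρ) / (deriv Z ρ) ^ 3 < 0 := by
  set P := derivWithin Z (Set.Ici 0)
  have hP : ContDiffOn ℝ 1 P (Set.Ici 0) :=
    hZ.derivWithin (uniqueDiffOn_Ici 0) (by norm_cast)
  have hPeq : ∀ ρ > (0 : ℝ), P ρ = deriv Z ρ := fun ρ hρ =>
    derivWithin_of_mem_nhds (Ici_mem_nhds hρ)
  have hn' : (0 : ℝ) < ((n : ℝ) - 1) + 1 := by
    rw [sub_add_cancel]
    exact_mod_cast (by omega : 0 < n)
  have hq : ∀ ρ > (0 : ℝ), deriv (deriv Z) ρ =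
      -(1 + P ρ ^ 2) * (Real.sqrt 2 / 2 + ((n : ℝ) - 1) * (P ρ / ρ)) := by
    intro ρ hρ
    have h := hODE ρ hρ
    have h1 : (0 : ℝ) < 1 + deriv Z ρ ^ 2 := by positivity
    rw [hPeq ρ hρ]
    have h2 : deriv (deriv Z) ρ / (1 + deriv Z ρ ^ 2) =
        -(Real.sqrt 2 / 2 + ((n : ℝ) - 1) * (deriv Z ρ / ρ)) := by
      linear_combination h
    rw [div_eq_iff h1.ne'] at h2
    linear_combination h2
  have hode : ∀ ρ > (0 : ℝ), HasDerivAt P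
      (-(1 + P ρ ^ 2) * (Real.sqrt 2 / 2 + ((n : ℝ) - 1) * (P ρ / ρ))) ρ := by
    intro ρ hρ
    have hev : P =ᶠ[nhds ρ] deriv Z := by
      filter_upwards [Ioi_mem_nhds hρ] with r hr using hPeq r hr
    rw [← hq ρ hρ, ← hev.deriv_eq]
    exact ((hP.differentiableOn one_ne_zero).differentiableAt (Ici_mem_nhds hρ)).hasDerivAt
  have hpos : ∀ ρ > (0 : ℝ), 0 < Real.sqrt 2 / 2 + ((n : ℝ) - 1) * (P ρ / ρ) := by
    intro ρ hρ
    have h := hZ'' ρ hρ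
    rw [hq ρ hρ, neg_mul, neg_lt_zero] at h
    exact pos_of_mul_pos_right h (by positivity)
  intro ρ hρ
  have key := soliton_ode_slope_sub_deriv_pos hn' hode
    (fun r hr => hPeq r hr ▸ hZ' r hr) hpos
    (tendsto_slope_zero_of_soliton_ode hn' hP hZ'0 hode) hρ
  have hmain : 0 < deriv Z ρ - ρ * deriv (deriv Z) ρ := by
    have h := mul_pos hρ key
    rw [mul_add, mul_div_cancel₀ _ hρ.ne'] at h
    rw [hq ρ hρ, ← hPeq ρ hρ]
    linarith
  exact ⟨hmain, div_neg_of_pos_of_neg (by positivity) (Odd.pow_neg (by decide) (hZ' ρ hρ))⟩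
end

section
/- Let n ≥ 2 be an integer and let Z : [0,∞) → ℝ be a C² function with Z(0) = 0 and Z'(0) = 0 that satisfies the Bowl-soliton ODE Z''(ρ)/(1+Z'(ρ)²) + ((n-1)/ρ)·Z'(ρ) + √2/2 = 0 for all ρ > 0. Then for every ρ > 0 the integral ∫₀^ρ Z'(s)²/s ds converges and (n-1)·∫₀^ρ Z'(s)²/s ds = -(√2/2)·Z(ρ) - (1/2)·log(1 + Z'(ρ)²). -/
open MeasureTheory

/-- The two expressions for the exponent of the tip-region weight coincide:
if `Z` is a `C²` function on `[0,∞)` with `Z(0) = 0`, `Z'(0) = 0` solving the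
Bowl-soliton ODE `Z''/(1+Z'²) + ((n-1)/ρ)Z' + √2/2 = 0` on `(0,∞)`, then for
every `ρ > 0` the integral `∫₀^ρ Z'(s)²/s ds` converges and
`(n-1)∫₀^ρ Z'(s)²/s ds = -(√2/2)Z(ρ) - (1/2)log(1+Z'(ρ)²)`. -/
theorem bowl_soliton_weight_identity (n : ℕ) (hn : 2 ≤ n) (Z : ℝ → ℝ)
    (hZ : ContDiffOn ℝ 2 Z (Set.Ici 0))
    (hZ0 : Z 0 = 0)
    (hZ'0 : derivWithin Z (Set.Ici 0) 0 = 0)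
    (hODE : ∀ ρ > (0 : ℝ),
      deriv (deriv Z) ρ / (1 + (deriv Z ρ) ^ 2)
        + ((n : ℝ) - 1) / ρ * deriv Z ρ + Real.sqrt 2 / 2 = 0) :
    ∀ ρ > (0 : ℝ),
      IntegrableOn (fun s => (deriv Z s) ^ 2 / s) (Set.Ioc 0 ρ) ∧
      ((n : ℝ) - 1) * ∫ s in Set.Ioc (0 : ℝ) ρ, (deriv Z s) ^ 2 / s =
        -(Real.sqrt 2 / 2) * Z ρ - (1 / 2) * Real.log (1 + (deriv Z ρ) ^ 2) := by
  have hu : UniqueDiffOn ℝ (Set.Ici (0 : ℝ)) := uniqueDiffOn_Ici 0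
  have hp : ContDiffOn ℝ 1 (derivWithin Z (Set.Ici 0)) (Set.Ici 0) :=
    hZ.derivWithin hu (by norm_num)
  have hpZ : ∀ s > (0 : ℝ), derivWithin Z (Set.Ici 0) s = deriv Z s := fun s hs =>
    derivWithin_of_mem_nhds (Ici_mem_nhds hs)
  have hd1 : ∀ s > (0 : ℝ), HasDerivAt Z (deriv Z s) s := fun s hs =>
    ((hZ.contDiffAt (Ici_mem_nhds hs)).differentiableAt (by norm_num)).hasDerivAt
  have hd2 : ∀ s > (0 : ℝ),
      HasDerivAt (derivWithin Z (Set.Ici 0)) (deriv (deriv Z) s) s := fun s hs => by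
    have h := ((hp.contDiffAt (Ici_mem_nhds hs)).differentiableAt (by norm_num)).hasDerivAt
    have heq : derivWithin Z (Set.Ici 0) =ᶠ[nhds s] deriv Z :=
      Filter.eventually_of_mem (Ioi_mem_nhds hs) hpZ
    rwa [heq.deriv_eq] at h
  have hn1 : (0 : ℝ) < (n : ℝ) - 1 := by
    have : (2 : ℝ) ≤ n := by exact_mod_cast hn
    linarith
  intro ρ hρ
  set F : ℝ → ℝ := fun s =>
    -(Real.sqrt 2 / 2) * Z s
      - (1 / 2) * Real.log (1 + (derivWithin Z (Set.Ici 0) s) ^ 2) with hF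
  have hFcont : ContinuousOn F (Set.Icc 0 ρ) := by
    have hZc : ContinuousOn Z (Set.Icc 0 ρ) := hZ.continuousOn.mono Set.Icc_subset_Ici_self
    have hpc : ContinuousOn (derivWithin Z (Set.Ici 0)) (Set.Icc 0 ρ) :=
      hp.continuousOn.mono Set.Icc_subset_Ici_self
    refine (hZc.const_mul _).sub (continuousOn_const.mul (ContinuousOn.log ?_ ?_))
    · exact continuousOn_const.add (hpc.pow 2)
    · intro s _
      positivity
  have hFderiv : ∀ s ∈ Set.Ioo 0 ρ,
      HasDerivAt F (((n : ℝ) - 1) * ((deriv Z s) ^ 2 / s)) s := fun s hs => by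
    have hs0 : 0 < s := hs.1
    have hpos : 0 < 1 + (deriv Z s) ^ 2 := by positivity
    have h := ((hd1 s hs0).const_mul (-(Real.sqrt 2 / 2))).sub
      (((((hd2 s hs0).pow 2).const_add 1).log
        (by simpa [hpZ s hs0] using hpos.ne')).const_mul (1 / 2))
    refine h.congr_deriv ?_
    have hode : Real.sqrt 2 / 2 = -(deriv (deriv Z) s / (1 + (deriv Z s) ^ 2))
        - ((n : ℝ) - 1) / s * deriv Z s := by linarith [hODE s hs0]
    simp only [hpZ s hs0, Pi.pow_apply]
    rw [hode]
    field_simp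
    ring
  have hint : IntegrableOn (fun s => ((n : ℝ) - 1) * ((deriv Z s) ^ 2 / s)) (Set.Ioc 0 ρ) :=
    intervalIntegral.integrableOn_deriv_of_nonneg hFcont hFderiv fun s hs => by
      have := hs.1
      positivity
  refine ⟨(integrable_const_mul_iff (Ne.isUnit hn1.ne') _).1 hint, ?_⟩
  have hftc := intervalIntegral.integral_eq_sub_of_hasDerivAt_of_le hρ.le hFcont hFderiv
    ((intervalIntegrable_iff_integrableOn_Ioc_of_le hρ.le).2 hint)
  rw [intervalIntegral.integral_of_le hρ.le, integral_const_mul] at hftc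
  simpa [hF, hZ0, hZ'0, hpZ ρ hρ] using hftc
end

section
/- Let n ≥ 2 be an integer and let Z : [0,∞) → ℝ be a C² function satisfying the Bowl-soliton ODE Z''(ρ)/(1+Z'(ρ)²) + ((n-1)/ρ)·Z'(ρ) + √2/2 = 0 for all ρ > 0, and assume Z'(ρ)/ρ → -1/(√2(n-1)) and Z''(ρ) → -1/(√2(n-1)) as ρ → ∞. Then there exist constants C > 0 and L₀ > 0 such that for every L ≥ L₀: |((n-1)/L)·(1 + Z'(L)²) + (√2/2)·Z'(L)| ≤ C/L. -/
open Filter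

/-- Bound on the limiting slope correction of the tip-region weight:
if `Z` is a `C²` function on `[0,∞)` solving the Bowl-soliton ODE
`Z''/(1+Z'²) + ((n-1)/ρ)Z' + √2/2 = 0` on `(0,∞)` with the Bowl-soliton
asymptotics `Z'(ρ)/ρ → -1/(√2(n-1))` and `Z''(ρ) → -1/(√2(n-1))` as `ρ → ∞`,
then there are `C > 0` and `L₀ > 0` such that for all `L ≥ L₀`
`|((n-1)/L)(1+Z'(L)²) + (√2/2)Z'(L)| ≤ C/L`. -/
theorem bowl_soliton_a_infinity_bound (n : ℕ) (hn : 2 ≤ n) (Z : ℝ → ℝ)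
    (hZ : ContDiffOn ℝ 2 Z (Set.Ici 0))
    (hODE : ∀ ρ > (0 : ℝ),
      deriv (deriv Z) ρ / (1 + (deriv Z ρ) ^ 2)
        + ((n : ℝ) - 1) / ρ * deriv Z ρ + Real.sqrt 2 / 2 = 0)
    (hlim1 : Tendsto (fun ρ => deriv Z ρ / ρ) atTop
      (nhds (-(1 / (Real.sqrt 2 * ((n : ℝ) - 1))))))
    (hlim2 : Tendsto (fun ρ => deriv (deriv Z) ρ) atTop
      (nhds (-(1 / (Real.sqrt 2 * ((n : ℝ) - 1)))))) :
    ∃ C : ℝ, 0 < C ∧ ∃ L₀ : ℝ, 0 < L₀ ∧ ∀ L ≥ L₀,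
      |((n : ℝ) - 1) / L * (1 + (deriv Z L) ^ 2) + Real.sqrt 2 / 2 * deriv Z L| ≤ C / L := by
  have hn1 : (0 : ℝ) < (n : ℝ) - 1 := by
    have : (2 : ℝ) ≤ n := by exact_mod_cast hn
    linarith
  have ha : 0 < 1 / (Real.sqrt 2 * ((n : ℝ) - 1)) := by positivity
  set a := 1 / (Real.sqrt 2 * ((n : ℝ) - 1)) with ha_def
  have h1 : ∀ᶠ ρ in atTop, deriv Z ρ / ρ < -(a / 2) :=
    hlim1.eventually_lt_const (by linarith)
  have h2 : ∀ᶠ ρ in atTop, |deriv (deriv Z) ρ| < a + 1 := by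
    refine hlim2.abs.eventually_lt_const ?_
    rw [abs_neg, abs_of_pos ha]
    linarith
  obtain ⟨R, hR⟩ := eventually_atTop.1 (h1.and h2)
  refine ⟨((n : ℝ) - 1) + 2 / a * (a + 1), by positivity, max R 1, by positivity,
    fun L hL => ?_⟩
  have hL0 : 0 < L := lt_of_lt_of_le one_pos ((le_max_right R 1).trans hL)
  obtain ⟨hp, hq⟩ := hR L ((le_max_left R 1).trans hL)
  have hode := hODE L hL0
  set p := deriv Z L
  set q := deriv (deriv Z) L
  have hden : 0 < 1 + p ^ 2 := by positivity
  have hr : |q / (1 + p ^ 2)| * (1 + p ^ 2) < a + 1 := by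
    rwa [abs_div, abs_of_pos hden, div_mul_cancel₀ _ hden.ne']
  set r := q / (1 + p ^ 2)
  have hLp : L ≤ 2 / a * |p| := by
    rw [div_lt_iff₀ hL0] at hp
    rw [div_mul_eq_mul_div, le_div_iff₀ ha]
    linarith [neg_le_abs p]
  have hkey : L * (|p| * |r|) ≤ 2 / a * (a + 1) := calc
    L * (|p| * |r|) ≤ 2 / a * |p| * (|p| * |r|) := by gcongr
    _ = 2 / a * (|r| * p ^ 2) := by rw [← sq_abs p]; ring
    _ ≤ 2 / a * (a + 1) := by
      gcongr
      linarith [abs_nonneg r]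
  have hrw : ((n : ℝ) - 1) / L * (1 + p ^ 2) + Real.sqrt 2 / 2 * p
      = ((n : ℝ) - 1) / L - p * r := by
    linear_combination p * hode
  rw [hrw, add_div]
  refine (abs_sub _ _).trans (add_le_add (abs_of_pos (by positivity)).le ?_)
  rwa [abs_mul, le_div_iff₀ hL0, mul_comm]
end

section
/- Let n ≥ 2 be an integer and let Z : [0,∞) → ℝ be a smooth function with Z(0) = 0, Z'(0) = 0 and Z'(ρ) < 0 for ρ > 0, satisfying the Bowl-soliton ODE Z''(ρ)/(1+Z'(ρ)²) + ((n-1)/ρ)·Z'(ρ) + √2/2 = 0 for all ρ > 0, and with Z'(ρ)/ρ → -1/(√2(n-1)) and Z''(ρ) → -1/(√2(n-1)) as ρ → ∞. Define m(ρ) := (n-1)·log ρ + (n-1)·∫₀^ρ Z'(s)²/s ds for ρ > 0 (the integral converges). Then for every a ∈ ℝ there exists δ > 0 such that for every compactly supported C¹ function f : [0,∞) → ℝ with f'(0) = 0: δ·∫₀^∞ f(ρ)² e^{m(ρ)+aρ} dρ ≤ ∫₀^∞ (f'(ρ)²/(1+Z'(ρ)²)) e^{m(ρ)+aρ} dρ.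 -/
open MeasureTheory Filter

/-- The exponent `m(ρ) = (n-1)log ρ + (n-1)∫₀^ρ Z'(s)²/s ds` of the
tip-region weight built from the Bowl soliton `Z`. -/
noncomputable def mWeight (n : ℕ) (Z : ℝ → ℝ) (ρ : ℝ) : ℝ :=
  ((n : ℝ) - 1) * Real.log ρ + ((n : ℝ) - 1) * ∫ s in Set.Ioc (0 : ℝ) ρ, (deriv Z s) ^ 2 / s

/-- A Hardy-type inequality: a flux `v` with `v 0 = 0`, `v' ≥ c w` and `v² ≤ M p w` yields a weighted
Poincaré inequality on `[0, ∞)` with weights `w` and `p`. -/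
theorem poincare_of_flux {w p v v' : ℝ → ℝ} {c M : ℝ} (hc : 0 < c) (hM : 0 < M)
    (hw : ContinuousOn w (Set.Ici 0)) (hp : ContinuousOn p (Set.Ici 0))
    (hv : ContinuousOn v (Set.Ici 0)) (hv0 : v 0 = 0)
    (hw_nonneg : ∀ x > 0, 0 ≤ w x) (hp_nonneg : ∀ x > 0, 0 ≤ p x)
    (hderiv : ∀ x > 0, HasDerivAt v (v' x) x) (hcw : ∀ x > 0, c * w x ≤ v' x)
    (hMpw : ∀ x > 0, v x ^ 2 ≤ M * (p x * w x))
    {f : ℝ → ℝ} (hf : ContDiffOn ℝ 1 f (Set.Ici 0)) (hR : ∃ R : ℝ, ∀ x ≥ R, f x = 0) :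
    c ^ 2 / (4 * M) * ∫ x in Set.Ioi (0 : ℝ), f x ^ 2 * w x ≤
      ∫ x in Set.Ioi (0 : ℝ), deriv f x ^ 2 * p x := by
  obtain ⟨R₀, hR₀⟩ := hR
  obtain ⟨R, hR0, hfR⟩ : ∃ R : ℝ, 0 < R ∧ ∀ x ≥ R, f x = 0 :=
    ⟨max R₀ 1, by positivity, fun x hx => hR₀ x (le_trans (le_max_left _ _) hx)⟩
  set g := derivWithin f (Set.Ici 0) with hg
  have hgc : ContinuousOn g (Set.Ici 0) :=
    hf.continuousOn_derivWithin (uniqueDiffOn_Ici 0) le_rfl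
  have hfc : ContinuousOn f (Set.Ici 0) := hf.continuousOn
  have hfd : ∀ x > 0, HasDerivAt f (g x) x := fun x hx =>
    ((hf.differentiableOn one_ne_zero x hx.le).hasDerivWithinAt).hasDerivAt (Ici_mem_nhds hx)
  have hsub : Set.Icc 0 R ⊆ Set.Ici (0 : ℝ) := fun x hx => hx.1
  have hA : ContinuousOn (fun x => f x ^ 2 * w x) (Set.Icc 0 R) :=
    ((hfc.pow 2).mul hw).mono hsub
  have hB : ContinuousOn (fun x => g x ^ 2 * p x) (Set.Icc 0 R) :=
    ((hgc.pow 2).mul hp).mono hsub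
  have hIA : ∫ x in Set.Ioi (0 : ℝ), f x ^ 2 * w x = ∫ x in (0 : ℝ)..R, f x ^ 2 * w x := by
    rw [intervalIntegral.integral_of_le hR0.le]
    refine setIntegral_eq_of_subset_of_forall_sdiff_eq_zero measurableSet_Ioi
      (fun x hx => hx.1) fun x hx => ?_
    have : R ≤ x := by
      by_contra h
      exact hx.2 ⟨hx.1, (not_le.mp h).le⟩
    simp [hfR x this]
  have hIB : ∫ x in Set.Ioi (0 : ℝ), deriv f x ^ 2 * p x = ∫ x in (0 : ℝ)..R, g x ^ 2 * p x := by
    rw [intervalIntegral.integral_of_le hR0.le]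
    rw [setIntegral_eq_of_subset_of_forall_sdiff_eq_zero (s := Set.Ioc 0 R) measurableSet_Ioi
      (fun x hx => hx.1)]
    · exact setIntegral_congr_fun measurableSet_Ioc fun x hx => by
        simp only [(hfd x hx.1).deriv]
    · intro x hx
      have : R < x := by
        by_contra h
        exact hx.2 ⟨hx.1, not_lt.mp h⟩
      have h0 : f =ᶠ[nhds x] fun _ => 0 := by
        filter_upwards [Ioi_mem_nhds this] with y hy using hfR y (le_of_lt hy)
      simp [h0.deriv_eq]
  rw [hIA, hIB]
  have hAint := hA.intervalIntegrable_of_Icc (μ := volume) hR0.le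
  have hBint := hB.intervalIntegrable_of_Icc (μ := volume) hR0.le
  have key := intervalIntegral.sub_le_integral_of_hasDeriv_right_of_le
    (g := fun x => -(f x ^ 2 * v x))
    (g' := fun x => -(2 * f x * g x * v x + f x ^ 2 * v' x))
    (φ := fun x => 2 * M / c * (g x ^ 2 * p x) - c / 2 * (f x ^ 2 * w x)) hR0.le
    (((hfc.pow 2).mul hv).neg.mono hsub)
    (fun x hx => by
      have h := (((hfd x hx.1).pow 2).mul (hderiv x hx.1)).neg
      refine (h.congr_deriv ?_).hasDerivWithinAt
      simp)
    (((hB.const_smul (2 * M / c)).sub (hA.const_smul (c / 2))).integrableOn_Icc)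
    (fun x hx => by
      have h1 := hcw x hx.1
      have h2 := hMpw x hx.1
      have h3 := hw_nonneg x hx.1
      have h4 := hp_nonneg x hx.1
      have h5 : -(2 * f x * g x * v x) ≤
          2 * M / c * (g x ^ 2 * p x) + c / 2 * (f x ^ 2 * w x) := by
        have hX : 0 ≤ 2 * M / c * (g x ^ 2 * p x) := by positivity
        have hY : 0 ≤ c / 2 * (f x ^ 2 * w x) := by positivity
        refine (abs_le_of_sq_le_sq' ?_ (add_nonneg hX hY)).2
        have h6 : (f x * g x) ^ 2 * v x ^ 2 ≤ (f x * g x) ^ 2 * (M * (p x * w x)) := by gcongr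
        have h7 : (2 * M / c * (g x ^ 2 * p x)) * (c / 2 * (f x ^ 2 * w x)) =
            (f x * g x) ^ 2 * (M * (p x * w x)) := by field_simp
        nlinarith [sq_nonneg (2 * M / c * (g x ^ 2 * p x) - c / 2 * (f x ^ 2 * w x))]
      have h8 : f x ^ 2 * (c * w x) ≤ f x ^ 2 * v' x := by gcongr
      linarith)
  simp only [hfR R le_rfl, hv0] at key
  rw [intervalIntegral.integral_sub (hBint.const_mul _) (hAint.const_mul _),
    intervalIntegral.integral_const_mul, intervalIntegral.integral_const_mul] at key
  rw [div_mul_eq_mul_div, div_le_iff₀ (by positivity)]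
  have h9 : c / 2 * ∫ x in (0 : ℝ)..R, f x ^ 2 * w x ≤
      2 * M / c * ∫ x in (0 : ℝ)..R, g x ^ 2 * p x := by linarith
  have h10 := mul_le_mul_of_nonneg_left h9 (show 0 ≤ 2 * c by positivity)
  have h11 : 2 * c * (2 * M / c * ∫ x in (0 : ℝ)..R, g x ^ 2 * p x) =
      (∫ x in (0 : ℝ)..R, g x ^ 2 * p x) * (4 * M) := by field_simp; ring
  linarith

/-- If `D` vanishes at `0` and is differentiable there, `D² / s` extends continuously by `0`. -/
theorem continuousOn_sq_div_self {D : ℝ → ℝ} (hD : DifferentiableOn ℝ D (Set.Ici 0))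
    (hD0 : D 0 = 0) : ContinuousOn (fun s => D s ^ 2 / s) (Set.Ici 0) := by
  intro x hx
  rcases (show (0 : ℝ) ≤ x from hx).eq_or_lt with rfl | hx0
  · have hd := (hD 0 hx).hasDerivWithinAt
    have h := ((hD 0 hx).continuousWithinAt.mono Set.sdiff_subset).tendsto.mul
      (hasDerivWithinAt_iff_tendsto_slope.mp hd)
    rw [← continuousWithinAt_sdiff_self]
    simp only [ContinuousWithinAt, hD0, zero_mul] at h ⊢
    refine (h.congr fun s => ?_).trans (by simp)
    simp [slope, hD0]
    ring
  · exact ((hD x hx).continuousWithinAt.pow 2).div continuousWithinAt_id hx0.ne'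

/-- Asymptotic form of the drift coefficient of the soliton weight. -/
theorem tendsto_soliton_drift {D : ℝ → ℝ} {N : ℝ} (hN : 0 < N) (a : ℝ)
    (hD : Tendsto (fun x => D x / x) atTop (nhds (-(1 / (Real.sqrt 2 * N))))) :
    Tendsto (fun x => N + 2 * N * (1 - 1 / (1 + D x ^ 2)) + Real.sqrt 2 * (x * D x / (1 + D x ^ 2))
      + a * (x / (1 + D x ^ 2))) atTop (nhds N) := by
  set L := -(1 / (Real.sqrt 2 * N)) with hL
  have hs : Real.sqrt 2 ^ 2 = 2 := Real.sq_sqrt (by norm_num)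
  have hs0 : 0 < Real.sqrt 2 := by positivity
  have hL0 : L ≠ 0 := by
    rw [hL]
    exact neg_ne_zero.mpr (by positivity)
  have hi : Tendsto (fun x : ℝ => x⁻¹) atTop (nhds 0) := tendsto_inv_atTop_zero
  have hq : Tendsto (fun x => x⁻¹ ^ 2 + (D x / x) ^ 2) atTop (nhds (0 ^ 2 + L ^ 2)) :=
    (hi.pow 2).add (hD.pow 2)
  have hq0 : (0 : ℝ) ^ 2 + L ^ 2 ≠ 0 := by positivity
  have h := ((tendsto_const_nhds (x := N)).add
    (((tendsto_const_nhds (x := (1 : ℝ))).sub ((hi.pow 2).div hq hq0)).const_mul (2 * N))).add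
    ((hD.div hq hq0).const_mul (Real.sqrt 2)) |>.add ((hi.div hq hq0).const_mul a)
  have hlim : N + 2 * N * (1 - 0 ^ 2 / (0 ^ 2 + L ^ 2)) + Real.sqrt 2 * (L / (0 ^ 2 + L ^ 2))
      + a * (0 / (0 ^ 2 + L ^ 2)) = N := by
    have : Real.sqrt 2 * (L / (0 ^ 2 + L ^ 2)) = -(2 * N) := by
      rw [hL]
      field_simp
      linarith [hs]
    rw [this]
    simp
  rw [hlim] at h
  refine h.congr' ?_
  filter_upwards [eventually_gt_atTop 0] with x hx
  have e : x⁻¹ ^ 2 + (D x / x) ^ 2 = (1 + D x ^ 2) / x ^ 2 := by field_simp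
  have hq1 : 0 < 1 + D x ^ 2 := by positivity
  simp only [Pi.div_apply, e]
  congr 1
  · congr 1
    · congr 3
      field_simp
    · field_simp
  · field_simp

/-- Away from a compact set `x²` is controlled by `D²` when `D x / x` has a nonzero limit. -/
theorem exists_sq_le_mul_one_add_sq {D : ℝ → ℝ} {L : ℝ} (hL : L ≠ 0)
    (hD : Tendsto (fun x => D x / x) atTop (nhds L)) :
    ∃ M > 0, ∀ x > 0, x ^ 2 ≤ M * (1 + D x ^ 2) := by
  have hL2 : 0 < L ^ 2 := by positivity
  have h := (hD.pow 2).eventually (eventually_gt_nhds (show L ^ 2 / 2 < L ^ 2 by linarith))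
  obtain ⟨R, hR⟩ := eventually_atTop.mp h
  refine ⟨R ^ 2 + 2 / L ^ 2, by positivity, fun x hx => ?_⟩
  by_cases hxR : R ≤ x
  · have h1 := hR x hxR
    rw [div_pow, lt_div_iff₀ (by positivity)] at h1
    have h2 : x ^ 2 ≤ 2 / L ^ 2 * D x ^ 2 := by
      rw [div_mul_eq_mul_div, le_div_iff₀ hL2]
      linarith
    have h3 : 0 ≤ R ^ 2 * (1 + D x ^ 2) := by positivity
    have h4 : 0 ≤ 2 / L ^ 2 := by positivity
    nlinarith
  · have h1 : x ^ 2 ≤ R ^ 2 := by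
      have := not_le.mp hxR
      gcongr
    have h3 : 0 ≤ R ^ 2 * D x ^ 2 := by positivity
    have h4 : 0 ≤ 2 / L ^ 2 * (1 + D x ^ 2) := by positivity
    nlinarith

/-- The correction `k / (1 + x)²` makes the drift coefficient uniformly positive. -/
theorem exists_drift_lower_bound {D : ℝ → ℝ} {N : ℝ} (hN : 1 ≤ N) (a : ℝ)
    (hDc : ContinuousOn D (Set.Ici 0))
    (hD : Tendsto (fun x => D x / x) atTop (nhds (-(1 / (Real.sqrt 2 * N))))) :
    ∃ k ≥ 0, ∀ x > 0, 1 / 2 ≤ (1 + k * x / (1 + x) ^ 2) / (1 + D x ^ 2) +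
      (N + 2 * N * (1 - 1 / (1 + D x ^ 2)) + Real.sqrt 2 * (x * D x / (1 + D x ^ 2))
        + a * (x / (1 + D x ^ 2))) := by
  have h := (tendsto_soliton_drift (by linarith) a hD).eventually
    (eventually_gt_nhds (show (1 / 2 : ℝ) < N by linarith))
  obtain ⟨R, hR⟩ := eventually_atTop.mp h
  have hc : ContinuousOn (fun x => -(Real.sqrt 2 * D x + a) * (1 + x) ^ 2) (Set.Icc 0 R) := by
    have := hDc.mono (fun x (hx : x ∈ Set.Icc 0 R) => hx.1)
    fun_prop
  obtain ⟨k, hk⟩ := isCompact_Icc.bddAbove_image hc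
  refine ⟨max k 0, le_max_right _ _, fun x hx => ?_⟩
  have hk0 : 0 ≤ max k 0 := le_max_right _ _
  have hq : 0 < 1 + D x ^ 2 := by positivity
  by_cases hxR : R ≤ x
  · have h1 := hR x hxR
    have h2 : 0 ≤ (1 + max k 0 * x / (1 + x) ^ 2) / (1 + D x ^ 2) := by positivity
    linarith
  · have h1 : -(Real.sqrt 2 * D x + a) * (1 + x) ^ 2 ≤ max k 0 :=
      (hk ⟨x, ⟨hx.le, (not_le.mp hxR).le⟩, rfl⟩).trans (le_max_left _ _)
    have h2 : -(Real.sqrt 2 * D x + a) * x ≤ max k 0 * x / (1 + x) ^ 2 := by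
      rw [le_div_iff₀ (by positivity)]
      nlinarith
    have h3 : 0 ≤ 2 * N * (1 - 1 / (1 + D x ^ 2)) := by
      have : 1 / (1 + D x ^ 2) ≤ 1 := by
        rw [div_le_one hq]
        nlinarith [sq_nonneg (D x)]
      exact mul_nonneg (by linarith) (by linarith)
    have h4 : 0 ≤ (1 + max k 0 * x / (1 + x) ^ 2 + (Real.sqrt 2 * D x + a) * x) / (1 + D x ^ 2) :=
      div_nonneg (by linarith) hq.le
    have h5 : (1 + max k 0 * x / (1 + x) ^ 2 + (Real.sqrt 2 * D x + a) * x) / (1 + D x ^ 2) =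
        (1 + max k 0 * x / (1 + x) ^ 2) / (1 + D x ^ 2) +
          Real.sqrt 2 * (x * D x / (1 + D x ^ 2)) + a * (x / (1 + D x ^ 2)) := by ring
    linarith

/-- Derivative of the flux `x e^{-k/(1+x)} w / (1 + D²)` along a solution of the soliton ODE. -/
theorem hasDerivAt_soliton_flux {D w : ℝ → ℝ} {D' N a k x : ℝ} (hx : 0 < x)
    (hD : HasDerivAt D D' x)
    (hODE : D' / (1 + D x ^ 2) + N / x * D x + Real.sqrt 2 / 2 = 0)
    (hw : HasDerivAt w (w x * (N / x + N * (D x ^ 2 / x) + a)) x) :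
    HasDerivAt (fun x => x * Real.exp (-(k / (1 + x))) * (w x / (1 + D x ^ 2)))
      (Real.exp (-(k / (1 + x))) * w x * ((1 + k * x / (1 + x) ^ 2) / (1 + D x ^ 2) +
        (N + 2 * N * (1 - 1 / (1 + D x ^ 2)) + Real.sqrt 2 * (x * D x / (1 + D x ^ 2))
          + a * (x / (1 + D x ^ 2))))) x := by
  have hq : 1 + D x ^ 2 ≠ 0 := by positivity
  have hx1 : 1 + x ≠ 0 := by positivity
  have hk : HasDerivAt (fun x => -(k / (1 + x))) (k / (1 + x) ^ 2) x := by
    have h := ((hasDerivAt_const x k).div ((hasDerivAt_id x).const_add 1) hx1).neg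
    refine h.congr_deriv ?_
    simp
    ring
  have hDq : HasDerivAt (fun x => 1 + D x ^ 2) (2 * D x * D') x := by
    refine ((hD.pow 2).const_add 1).congr_deriv ?_
    simp
  have h := ((hasDerivAt_id x).mul hk.exp).mul (hw.div hDq hq)
  refine h.congr_deriv ?_
  have hD' : D' = -(N / x * D x + Real.sqrt 2 / 2) * (1 + D x ^ 2) := by
    field_simp at hODE ⊢
    linarith
  simp only [id, hD', Pi.mul_apply, Pi.div_apply]
  generalize Real.exp (-(k / (1 + x))) = e
  generalize Real.sqrt 2 = s
  field_simp
  ring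

/-- Continuous representative on `[0, ∞)` of the soliton weight. -/
theorem exists_soliton_weight {D : ℝ → ℝ} (hD : DifferentiableOn ℝ D (Set.Ici 0))
    (hD0 : D 0 = 0) (N : ℕ) (a : ℝ) :
    ∃ w : ℝ → ℝ, ContinuousOn w (Set.Ici 0) ∧
      (∀ x > 0, HasDerivAt w (w x * (N / x + N * (D x ^ 2 / x) + a)) x) ∧
      ∀ x > 0, w x =
        Real.exp (N * Real.log x + N * (∫ s in Set.Ioc 0 x, D s ^ 2 / s) + a * x) := by
  set E : ℝ → ℝ := fun s => D (max s 0) ^ 2 / max s 0 with hE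
  have hEc : Continuous E :=
    (continuousOn_sq_div_self hD hD0).comp_continuous (by fun_prop) fun s => le_max_right s 0
  have hI : ∀ x, HasDerivAt (fun x => ∫ s in (0 : ℝ)..x, E s) (E x) x := fun x =>
    hEc.integral_hasStrictDerivAt 0 x |>.hasDerivAt
  have hw : ∀ x > 0, x ^ N * Real.exp (N * (∫ s in (0 : ℝ)..x, E s) + a * x) =
      Real.exp (N * Real.log x + N * (∫ s in (0 : ℝ)..x, E s) + a * x) := fun x hx => by
    rw [add_assoc, Real.exp_add (N * Real.log x), Real.exp_nat_mul, Real.exp_log hx]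
  refine ⟨fun x => x ^ N * Real.exp (N * (∫ s in (0 : ℝ)..x, E s) + a * x), ?_, ?_, ?_⟩
  · exact Continuous.continuousOn (by fun_prop)
  · intro x hx
    have h1 := ((((Real.hasDerivAt_log hx.ne').const_mul (N : ℝ)).add
      ((hI x).const_mul (N : ℝ))).add ((hasDerivAt_id x).const_mul a)).exp
    refine (h1.congr_of_eventuallyEq ?_).congr_deriv ?_
    · filter_upwards [Ioi_mem_nhds hx] with y hy using hw y hy
    · have hEx : E x = D x ^ 2 / x := by simp only [hE, max_eq_left hx.le]
      simp only [hEx, Pi.add_apply, id, ← hw x hx]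
      ring
  · intro x hx
    have : ∫ s in (0 : ℝ)..x, E s = ∫ s in Set.Ioc 0 x, D s ^ 2 / s := by
      rw [intervalIntegral.integral_of_le hx.le]
      exact setIntegral_congr_fun measurableSet_Ioc fun s hs => by
        simp only [hE, max_eq_left hs.1.le]
    rw [← this]
    exact hw x hx

/-- **Weighted Poincaré inequality on the soliton scale**: let `Z` be smooth
on `[0,∞)` with `Z(0) = 0`, `Z'(0) = 0`, `Z' < 0` on `(0,∞)`, solving the
Bowl-soliton ODE `Z''/(1+Z'²) + ((n-1)/ρ)Z' + √2/2 = 0` on `(0,∞)` and having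
the Bowl-soliton asymptotics `Z'(ρ)/ρ → -1/(√2(n-1))`, `Z''(ρ) → -1/(√2(n-1))`.
Then for every `a ∈ ℝ` there is `δ > 0` such that every compactly supported
`C¹` function `f : [0,∞) → ℝ` with `f'(0) = 0` satisfies
`δ ∫₀^∞ f² e^{m+aρ} dρ ≤ ∫₀^∞ (f'²/(1+Z'²)) e^{m+aρ} dρ`. -/
theorem tip_region_weighted_poincare (n : ℕ) (hn : 2 ≤ n) (Z : ℝ → ℝ)
    (hZ : ContDiffOn ℝ (⊤ : ℕ∞) Z (Set.Ici 0))
    (hZ0 : Z 0 = 0)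
    (hZ'0 : derivWithin Z (Set.Ici 0) 0 = 0)
    (hZ' : ∀ ρ > (0 : ℝ), deriv Z ρ < 0)
    (hODE : ∀ ρ > (0 : ℝ),
      deriv (deriv Z) ρ / (1 + (deriv Z ρ) ^ 2)
        + ((n : ℝ) - 1) / ρ * deriv Z ρ + Real.sqrt 2 / 2 = 0)
    (hlim1 : Tendsto (fun ρ => deriv Z ρ / ρ) atTop
      (nhds (-(1 / (Real.sqrt 2 * ((n : ℝ) - 1))))))
    (hlim2 : Tendsto (fun ρ => deriv (deriv Z) ρ) atTop
      (nhds (-(1 / (Real.sqrt 2 * ((n : ℝ) - 1)))))) :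
    ∀ a : ℝ, ∃ δ : ℝ, 0 < δ ∧
      ∀ f : ℝ → ℝ, ContDiffOn ℝ 1 f (Set.Ici 0) →
        (∃ R : ℝ, ∀ ρ ≥ R, f ρ = 0) →
        derivWithin f (Set.Ici 0) 0 = 0 →
        δ * ∫ ρ in Set.Ioi (0 : ℝ), (f ρ) ^ 2 * Real.exp (mWeight n Z ρ + a * ρ) ≤
          ∫ ρ in Set.Ioi (0 : ℝ),
            (deriv f ρ) ^ 2 / (1 + (deriv Z ρ) ^ 2) * Real.exp (mWeight n Z ρ + a * ρ) := by
  intro a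
  set D := derivWithin Z (Set.Ici 0) with hDdef
  have hDd : DifferentiableOn ℝ D (Set.Ici 0) :=
    ((contDiffOn_infty_iff_derivWithin (uniqueDiffOn_Ici 0)).mp hZ).2.differentiableOn (by simp)
  have hDeq : ∀ x > 0, D x = deriv Z x := fun x hx => derivWithin_of_mem_nhds (Ici_mem_nhds hx)
  have hDD : ∀ x > 0, HasDerivAt D (deriv (deriv Z) x) x := fun x hx => by
    have h : D =ᶠ[nhds x] deriv Z := by
      filter_upwards [Ioi_mem_nhds hx] with y hy using hDeq y hy
    rw [← h.deriv_eq]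
    exact ((hDd x hx.le).differentiableAt (Ici_mem_nhds hx)).hasDerivAt
  have hcast : ((n - 1 : ℕ) : ℝ) = (n : ℝ) - 1 := by
    rw [Nat.cast_sub (by lia), Nat.cast_one]
  have hN : (1 : ℝ) ≤ (n : ℝ) - 1 := by
    have : (2 : ℝ) ≤ n := by exact_mod_cast hn
    linarith
  have hlim : Tendsto (fun x => D x / x) atTop
      (nhds (-(1 / (Real.sqrt 2 * ((n : ℝ) - 1))))) := by
    refine hlim1.congr' ?_
    filter_upwards [eventually_gt_atTop 0] with x hx
    rw [hDeq x hx]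
  obtain ⟨w, hwc, hwd, hwe⟩ := exists_soliton_weight hDd hZ'0 (n - 1) a
  rw [hcast] at hwd hwe
  have hwm : ∀ x > 0, w x = Real.exp (mWeight n Z x + a * x) := fun x hx => by
    rw [hwe x hx, mWeight]
    congr 4
    exact setIntegral_congr_fun measurableSet_Ioc fun s hs => by simp only [hDeq s hs.1]
  have hwpos : ∀ x > 0, 0 < w x := fun x hx => by
    rw [hwm x hx]
    positivity
  obtain ⟨M, hM, hMD⟩ := exists_sq_le_mul_one_add_sq
    (neg_ne_zero.mpr (by positivity)) hlim
  obtain ⟨k, hk, hkD⟩ := exists_drift_lower_bound hN a hDd.continuousOn hlim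
  have hpc : ContinuousOn (fun x => w x / (1 + D x ^ 2)) (Set.Ici 0) :=
    hwc.div (continuousOn_const.add (hDd.continuousOn.pow 2)) fun x _ => by positivity
  refine ⟨(Real.exp (-k) / 2) ^ 2 / (4 * M), by positivity, fun f hf hfR _ => ?_⟩
  have main := poincare_of_flux (c := Real.exp (-k) / 2) (M := M) (by positivity) hM hwc hpc
    (v := fun x => x * Real.exp (-(k / (1 + x))) * (w x / (1 + D x ^ 2)))
    (ContinuousOn.mul (continuousOn_id.mul (Real.continuous_exp.comp_continuousOn
      (continuousOn_const.div (continuousOn_const.add continuousOn_id) fun x hx => by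
        have : (0 : ℝ) ≤ x := hx
        exact (show 0 < 1 + x by positivity).ne').neg)) hpc)
    (by simp) (fun x hx => (hwpos x hx).le)
    (fun x hx => div_nonneg (hwpos x hx).le (by positivity))
    (fun x hx => hasDerivAt_soliton_flux (k := k) hx (hDD x hx)
      (by rw [hDeq x hx]; exact hODE x hx) (hwd x hx))
    (fun x hx => by
      have hw := (hwpos x hx).le
      have h1 : Real.exp (-k) ≤ Real.exp (-(k / (1 + x))) :=
        Real.exp_le_exp.mpr (neg_le_neg (div_le_self hk (by linarith)))
      calc Real.exp (-k) / 2 * w x = Real.exp (-k) * w x * (1 / 2) := by ring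
        _ ≤ _ := mul_le_mul (mul_le_mul_of_nonneg_right h1 hw) (hkD x hx) (by norm_num)
          (by positivity))
    (fun x hx => by
      have hw := (hwpos x hx).le
      have h1 : Real.exp (-(k / (1 + x))) ≤ 1 :=
        Real.exp_le_one_iff.mpr (neg_nonpos.mpr (by positivity))
      have h2 : (x * Real.exp (-(k / (1 + x)))) ^ 2 ≤ M * (1 + D x ^ 2) := by
        refine le_trans ?_ (hMD x hx)
        gcongr
        exact mul_le_of_le_one_right hx.le h1
      calc (x * Real.exp (-(k / (1 + x))) * (w x / (1 + D x ^ 2))) ^ 2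
          = (x * Real.exp (-(k / (1 + x)))) ^ 2 * (w x / (1 + D x ^ 2)) ^ 2 := by ring
        _ ≤ M * (1 + D x ^ 2) * (w x / (1 + D x ^ 2)) ^ 2 := by gcongr
        _ = M * (w x / (1 + D x ^ 2) * w x) := by field_simp)
    hf hfR
  have hleft : ∫ x in Set.Ioi (0 : ℝ), f x ^ 2 * Real.exp (mWeight n Z x + a * x) =
      ∫ x in Set.Ioi (0 : ℝ), f x ^ 2 * w x :=
    setIntegral_congr_fun measurableSet_Ioi fun x hx => by simp only [hwm x hx]
  have hright : ∫ x in Set.Ioi (0 : ℝ),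
      deriv f x ^ 2 / (1 + deriv Z x ^ 2) * Real.exp (mWeight n Z x + a * x) =
      ∫ x in Set.Ioi (0 : ℝ), deriv f x ^ 2 * (w x / (1 + D x ^ 2)) :=
    setIntegral_congr_fun measurableSet_Ioi fun x hx => by
      simp only [hwm x hx, hDeq x hx]
      ring
  rw [hleft, hright]
  exact main
end

section
/- Let n ≥ 2 be an integer, let x₀, t₀ ∈ ℝ, let r > 0, and let ℓ ≥ √(2n+1)·r. Suppose U : [x₀-2ℓ, x₀+2ℓ] × [t₀-r², t₀] → (0,∞) is continuous, C² in x and C¹ in t, concave in x (U_xx ≤ 0), satisfies ∂_t U = U_xx/(1+U_x²) - (n-1)/U, and U(x₀, t₀) = r. Then for every x ∈ [x₀-ℓ, x₀+ℓ] and every t ∈ (t₀-r², t₀] one has U(x,t) + ℓ·|U_x(x,t)| ≤ 8√(2n+1)·r. -/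
/-- Partial derivative in `x` of `U(x,t)` within the slab `s` of `x`-values. -/
noncomputable def pUx (U : ℝ → ℝ → ℝ) (s : Set ℝ) (x t : ℝ) : ℝ :=
  derivWithin (fun x' => U x' t) s x

/-- Second partial derivative in `x` of `U(x,t)` within the slab `s`. -/
noncomputable def pUxx (U : ℝ → ℝ → ℝ) (s : Set ℝ) (x t : ℝ) : ℝ :=
  derivWithin (fun x' => pUx U s x' t) s x

/-- Partial derivative in `t` of `U(x,t)` within the time interval `s`. -/
noncomputable def pUt (U : ℝ → ℝ → ℝ) (s : Set ℝ) (x t : ℝ) : ℝ :=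
  derivWithin (fun t' => U x t') s t

open Set Filter Topology

theorem IsLocalMin.deriv_deriv_nonneg {f : ℝ → ℝ} {x : ℝ} (hf : IsLocalMin f x)
    (hc : ContinuousAt f x) : 0 ≤ deriv (deriv f) x := by
  by_contra! hneg
  have hmax := isLocalMax_of_deriv_deriv_neg hneg hf.deriv_eq_zero hc
  have hconst : f =ᶠ[𝓝 x] fun _ => f x := by
    filter_upwards [hf, hmax] with y h₁ h₂ using le_antisymm h₂ h₁
  have hzero : deriv (deriv f) x = 0 := by
    rw [hconst.deriv.deriv_eq]
    simp
  exact hneg.ne hzero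

theorem IsMinOn.hasDerivWithinAt_Icc_nonpos {f : ℝ → ℝ} {c d t f' : ℝ}
    (hmin : IsMinOn f (Icc c d) t) (ht : t ∈ Ioc c d)
    (hf : HasDerivWithinAt f f' (Icc c d) t) : f' ≤ 0 := by
  have hcone : c - t ∈ posTangentConeAt (Icc c d) t := by
    refine sub_mem_posTangentConeAt_of_segment_subset ?_
    exact (convex_Icc c d).segment_subset (Ioc_subset_Icc_self ht)
      ⟨le_rfl, (ht.1.trans_le ht.2).le⟩
  have h := hmin.localize.hasFDerivWithinAt_nonneg hf.hasFDerivWithinAt hcone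
  simp only [ContinuousLinearMap.toSpanSingleton_apply, smul_eq_mul] at h
  nlinarith [ht.1]

/-- Weak minimum principle for supersolutions `∂_t W ≥ k ∂_x² W`, `k ≥ 0`, of a degenerate
parabolic equation on a rectangle. -/
theorem parabolic_minimum_principle {W : ℝ → ℝ → ℝ} {a b c d m : ℝ}
    (hcont : ContinuousOn (Function.uncurry W) (Icc a b ×ˢ Icc c d))
    (hsuper : ∀ x ∈ Ioo a b, ∀ t ∈ Ioc c d, ContinuousAt (fun y => W y t) x ∧
      ∃ w k : ℝ, 0 ≤ k ∧ HasDerivWithinAt (fun s => W x s) w (Icc c d) t ∧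
        k * deriv (deriv fun y => W y t) x ≤ w)
    (hinit : ∀ x ∈ Icc a b, m ≤ W x c)
    (hleft : ∀ t ∈ Icc c d, m ≤ W a t) (hright : ∀ t ∈ Icc c d, m ≤ W b t)
    {x t : ℝ} (hx : x ∈ Icc a b) (ht : t ∈ Icc c d) : m ≤ W x t := by
  by_contra! hlt
  obtain ⟨ε, hε, hεlt⟩ : ∃ ε > 0, W x t + ε * (t - c) < m := by
    have hden : 0 < t - c + 1 := by linarith [ht.1]
    refine ⟨(m - W x t) / (t - c + 1), div_pos (sub_pos.2 hlt) hden, ?_⟩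
    have : (m - W x t) / (t - c + 1) * (t - c + 1) = m - W x t :=
      div_mul_cancel₀ _ hden.ne'
    nlinarith [div_pos (sub_pos.2 hlt) hden]
  have hVcont : ContinuousOn (fun p : ℝ × ℝ => Function.uncurry W p + ε * (p.2 - c))
      (Icc a b ×ˢ Icc c d) := hcont.add (by fun_prop)
  obtain ⟨⟨y, s⟩, ⟨hy, hs⟩, hmin⟩ :=
    (isCompact_Icc.prod isCompact_Icc).exists_isMinOn ⟨(x, t), hx, ht⟩ hVcont
  have hmin' : ∀ y' ∈ Icc a b, ∀ s' ∈ Icc c d,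
      W y s + ε * (s - c) ≤ W y' s' + ε * (s' - c) := fun y' hy' s' hs' =>
    isMinOn_iff.1 hmin (y', s') ⟨hy', hs'⟩
  have hWlt : W y s < m := by
    have := hmin' x hx t ht
    nlinarith [hs.1]
  have hcs : c < s := lt_of_le_of_ne hs.1 fun h => by
    subst h
    exact (hinit y hy).not_gt hWlt
  have hay : a < y := lt_of_le_of_ne hy.1 fun h => by
    subst h
    exact (hleft s hs).not_gt hWlt
  have hyb : y < b := lt_of_le_of_ne hy.2 fun h => by
    subst h
    exact (hright s hs).not_gt hWlt
  obtain ⟨hcy, w, k, hk, hw, hkw⟩ := hsuper y ⟨hay, hyb⟩ s ⟨hcs, hs.2⟩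
  have hloc : IsLocalMin (fun y' => W y' s) y := by
    filter_upwards [Icc_mem_nhds hay hyb] with y' hy'
    have := hmin' y' hy' s hs
    linarith
  have hderiv : HasDerivWithinAt (fun s' => W y s' + ε * (s' - c)) (w + ε * 1) (Icc c d) s :=
    hw.add (((hasDerivWithinAt_id s _).sub_const c).const_mul ε)
  have htime : w + ε * 1 ≤ 0 :=
    IsMinOn.hasDerivWithinAt_Icc_nonpos (isMinOn_iff.2 fun s' hs' => hmin' y hy s' hs')
      ⟨hcs, hs.2⟩ hderiv
  linarith [mul_nonneg hk (hloc.deriv_deriv_nonneg hcy)]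

theorem ContDiffOn.hasDerivAt_derivWithin_Icc {u : ℝ → ℝ} {a b x : ℝ}
    (hu : ContDiffOn ℝ 2 u (Icc a b)) (hx : x ∈ Ioo a b) :
    HasDerivAt u (derivWithin u (Icc a b) x) x :=
  ((hu.differentiableOn (by norm_num)) x (Ioo_subset_Icc_self hx)).hasDerivWithinAt.hasDerivAt
    (Icc_mem_nhds hx.1 hx.2)

theorem ContDiffOn.hasDerivAt_derivWithin_derivWithin_Icc {u : ℝ → ℝ} {a b x : ℝ}
    (hu : ContDiffOn ℝ 2 u (Icc a b)) (hx : x ∈ Ioo a b) :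
    HasDerivAt (derivWithin u (Icc a b))
      (derivWithin (derivWithin u (Icc a b)) (Icc a b) x) x := by
  have h := hu.derivWithin (m := 1) (uniqueDiffOn_Icc (hx.1.trans hx.2)) (by norm_num)
  exact ((h.differentiableOn (by norm_num)) x
    (Ioo_subset_Icc_self hx)).hasDerivWithinAt.hasDerivAt (Icc_mem_nhds hx.1 hx.2)

theorem deriv_deriv_sq_add_sq {u : ℝ → ℝ} {a b x y C : ℝ}
    (hu : ContDiffOn ℝ 2 u (Icc a b)) (hx : x ∈ Ioo a b) :
    deriv (deriv fun z => u z ^ 2 + (z - y) ^ 2 + C) x =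
      2 * derivWithin u (Icc a b) x ^ 2 +
        2 * u x * derivWithin (derivWithin u (Icc a b)) (Icc a b) x + 2 := by
  have hfirst : deriv (fun z => u z ^ 2 + (z - y) ^ 2 + C) =ᶠ[𝓝 x]
      fun z => 2 * (u z * derivWithin u (Icc a b) z) + 2 * (z - y) := by
    filter_upwards [Ioo_mem_nhds hx.1 hx.2] with z hz
    have h := (((hu.hasDerivAt_derivWithin_Icc hz).pow 2).add
      (((hasDerivAt_id z).sub_const y).pow 2)).add_const C
    refine HasDerivAt.deriv (h.congr_deriv ?_)
    simp
    ring
  rw [hfirst.deriv_eq]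
  have h := (((hu.hasDerivAt_derivWithin_Icc hx).mul
    (hu.hasDerivAt_derivWithin_derivWithin_Icc hx)).const_mul 2).add
      (((hasDerivAt_id x).sub_const y).const_mul 2)
  refine HasDerivAt.deriv (h.congr_deriv ?_)
  simp
  ring

theorem ContDiffOn.concaveOn_Icc {u : ℝ → ℝ} {a b : ℝ} (hu : ContDiffOn ℝ 2 u (Icc a b))
    (hneg : ∀ x ∈ Icc a b, derivWithin (derivWithin u (Icc a b)) (Icc a b) x ≤ 0) :
    ConcaveOn ℝ (Icc a b) u := by
  refine concaveOn_of_hasDerivWithinAt2_nonpos (f' := derivWithin u (Icc a b))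
    (f'' := derivWithin (derivWithin u (Icc a b)) (Icc a b)) (convex_Icc a b)
    hu.continuousOn ?_ ?_ ?_ <;> intro x hx <;>
    have hx' : x ∈ Ioo a b := by simpa [interior_Icc] using hx
  · exact (hu.hasDerivAt_derivWithin_Icc hx').hasDerivWithinAt
  · exact (hu.hasDerivAt_derivWithin_derivWithin_Icc hx').hasDerivWithinAt
  · exact hneg x (Ioo_subset_Icc_self hx')

/-- A nonnegative concave function lies above the tent over its value at the midpoint. -/
theorem ConcaveOn.mul_sub_abs_le {u : ℝ → ℝ} {y p x : ℝ} (hp : 0 < p)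
    (hu : ConcaveOn ℝ (Icc (y - p) (y + p)) u)
    (hpos : ∀ z ∈ Icc (y - p) (y + p), 0 ≤ u z) (hx : x ∈ Icc (y - p) (y + p)) :
    u y * (p - |x - y|) ≤ u x * p := by
  have key : ∀ e ∈ Icc (y - p) (y + p), ∀ θ : ℝ, 0 ≤ θ → θ ≤ 1 →
      x = (1 - θ) * y + θ * e → (1 - θ) * u y ≤ u x := by
    intro e he θ h₀ h₁ hxe
    have hy : y ∈ Icc (y - p) (y + p) := ⟨by linarith, by linarith⟩
    have h := hu.2 hy he (sub_nonneg.2 h₁) h₀ (by ring)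
    simp only [smul_eq_mul] at h
    rw [← hxe] at h
    linarith [mul_nonneg h₀ (hpos e he)]
  have hθ : |x - y| / p * p = |x - y| := div_mul_cancel₀ _ hp.ne'
  have hθ₁ : |x - y| / p ≤ 1 := by
    rw [div_le_one hp, abs_le]
    exact ⟨by linarith [hx.1], by linarith [hx.2]⟩
  have hmain : (1 - |x - y| / p) * u y ≤ u x := by
    rcases le_total y x with h | h
    · refine key (y + p) ⟨by linarith, le_rfl⟩ _ (by positivity) hθ₁ ?_
      rw [abs_of_nonneg (sub_nonneg.2 h)] at hθ ⊢
      linear_combination -hθ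
    · refine key (y - p) ⟨le_rfl, by linarith⟩ _ (by positivity) hθ₁ ?_
      rw [abs_of_nonpos (sub_nonpos.2 h)] at hθ ⊢
      linear_combination hθ
  calc u y * (p - |x - y|) = (1 - |x - y| / p) * u y * p := by
        linear_combination (u y) * hθ
    _ ≤ u x * p := mul_le_mul_of_nonneg_right hmain hp.le

/-- Value and slope of a positive concave function on the middle half of an interval are
controlled by its value at the midpoint. -/
theorem ConcaveOn.add_mul_abs_deriv_le {u : ℝ → ℝ} {y l x u' : ℝ} (hl : 0 < l)
    (hu : ConcaveOn ℝ (Icc (y - 2 * l) (y + 2 * l)) u)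
    (hpos : ∀ z ∈ Icc (y - 2 * l) (y + 2 * l), 0 < u z)
    (hx : x ∈ Icc (y - l) (y + l)) (hderiv : HasDerivAt u u' x) :
    u x + l * |u'| ≤ 3 * u y := by
  have hL : y - 2 * l ∈ Icc (y - 2 * l) (y + 2 * l) := ⟨le_rfl, by linarith⟩
  have hR : y + 2 * l ∈ Icc (y - 2 * l) (y + 2 * l) := ⟨by linarith, le_rfl⟩
  have hy : y ∈ Icc (y - 2 * l) (y + 2 * l) := ⟨by linarith, by linarith⟩
  have hx' : x ∈ Icc (y - 2 * l) (y + 2 * l) := ⟨by linarith [hx.1], by linarith [hx.2]⟩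
  have hux := hpos x hx'
  have hright : -u' * l ≤ u x := by
    have hxy : x < y + 2 * l := by linarith [hx.2]
    have h := hu.slope_le_of_hasDerivAt hx' hR hxy hderiv
    rw [slope_def_field, div_le_iff₀ (sub_pos.2 hxy)] at h
    have := hpos _ hR
    nlinarith [hx.2]
  have hleft : u' * l ≤ u x := by
    have hxy : y - 2 * l < x := by linarith [hx.1]
    have h := hu.le_slope_of_hasDerivAt hL hx' hxy hderiv
    rw [slope_def_field, le_div_iff₀ (sub_pos.2 hxy)] at h
    have := hpos _ hL
    nlinarith [hx.1]
  have habs : l * |u'| ≤ u x := by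
    rcases abs_cases u' with ⟨h, -⟩ | ⟨h, -⟩ <;> rw [h] <;> linarith
  have hval : 2 * u x ≤ 3 * u y := by
    rcases le_total y x with h | h
    · rcases h.eq_or_lt with rfl | h
      · linarith
      have hs := hu.slope_anti_adjacent hL hx' (by linarith) h
      rw [div_le_div_iff₀ (sub_pos.2 h) (by linarith)] at hs
      nlinarith [hpos _ hL, hpos _ hy, hx.2]
    · rcases h.eq_or_lt with rfl | h
      · linarith
      have hs := hu.slope_anti_adjacent hx' hR h (by linarith)
      rw [div_le_div_iff₀ (by linarith) (sub_pos.2 h)] at hs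
      nlinarith [hpos _ hR, hpos _ hy, hx.1]
  linarith

/-- Quantified interior estimate for convex rotationally symmetric MCF:
if the concave-in-`x` positive profile `U` solves
`∂_t U = U_xx/(1+U_x²) - (n-1)/U` on `[x₀-2ℓ, x₀+2ℓ] × [t₀-r², t₀]`, where
`ℓ ≥ √(2n+1) r` and `U(x₀,t₀) = r`, then
`U(x,t) + ℓ|U_x(x,t)| ≤ 8√(2n+1) r` for `x ∈ [x₀-ℓ, x₀+ℓ]`, `t ∈ (t₀-r², t₀]`. -/
theorem profile_gradient_estimate (n : ℕ) (hn : 2 ≤ n)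
    (x₀ t₀ r ℓ : ℝ) (hr : 0 < r)
    (hℓ : Real.sqrt (2 * (n : ℝ) + 1) * r ≤ ℓ)
    (U : ℝ → ℝ → ℝ)
    (hpos : ∀ x ∈ Set.Icc (x₀ - 2 * ℓ) (x₀ + 2 * ℓ), ∀ t ∈ Set.Icc (t₀ - r ^ 2) t₀,
      0 < U x t)
    (hcont : ContinuousOn (Function.uncurry U)
      (Set.Icc (x₀ - 2 * ℓ) (x₀ + 2 * ℓ) ×ˢ Set.Icc (t₀ - r ^ 2) t₀))
    (hCx : ∀ t ∈ Set.Icc (t₀ - r ^ 2) t₀,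
      ContDiffOn ℝ 2 (fun x => U x t) (Set.Icc (x₀ - 2 * ℓ) (x₀ + 2 * ℓ)))
    (hCt : ∀ x ∈ Set.Icc (x₀ - 2 * ℓ) (x₀ + 2 * ℓ),
      ContDiffOn ℝ 1 (fun t => U x t) (Set.Icc (t₀ - r ^ 2) t₀))
    (hconc : ∀ x ∈ Set.Icc (x₀ - 2 * ℓ) (x₀ + 2 * ℓ), ∀ t ∈ Set.Icc (t₀ - r ^ 2) t₀,
      pUxx U (Set.Icc (x₀ - 2 * ℓ) (x₀ + 2 * ℓ)) x t ≤ 0)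
    (hPDE : ∀ x ∈ Set.Icc (x₀ - 2 * ℓ) (x₀ + 2 * ℓ), ∀ t ∈ Set.Icc (t₀ - r ^ 2) t₀,
      pUt U (Set.Icc (t₀ - r ^ 2) t₀) x t =
        pUxx U (Set.Icc (x₀ - 2 * ℓ) (x₀ + 2 * ℓ)) x t
            / (1 + (pUx U (Set.Icc (x₀ - 2 * ℓ) (x₀ + 2 * ℓ)) x t) ^ 2)
          - ((n : ℝ) - 1) / U x t)
    (hU0 : U x₀ t₀ = r) :
    ∀ x ∈ Set.Icc (x₀ - ℓ) (x₀ + ℓ), ∀ t ∈ Set.Ioc (t₀ - r ^ 2) t₀,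
      U x t + ℓ * |pUx U (Set.Icc (x₀ - 2 * ℓ) (x₀ + 2 * ℓ)) x t| ≤
        8 * Real.sqrt (2 * (n : ℝ) + 1) * r := by
  have hA : 0 < 2 * (n : ℝ) + 1 := by positivity
  set q := Real.sqrt (2 * (n : ℝ) + 1) with hq
  have hq0 : 0 < q := Real.sqrt_pos.2 hA
  have hqsq : q ^ 2 = 2 * (n : ℝ) + 1 := Real.sq_sqrt hA.le
  have hqr : 0 < q * r := mul_pos hq0 hr
  have hl : 0 < ℓ := hqr.trans_le hℓ
  intro x hx t ht
  have htI : t ∈ Set.Icc (t₀ - r ^ 2) t₀ := Set.Ioc_subset_Icc_self ht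
  have hx₀ : x₀ ∈ Set.Icc (x₀ - 2 * ℓ) (x₀ + 2 * ℓ) := ⟨by linarith, by linarith⟩
  have hxI : x ∈ Set.Ioo (x₀ - 2 * ℓ) (x₀ + 2 * ℓ) :=
    ⟨by linarith [hx.1], by linarith [hx.2]⟩
  have hconcave : ConcaveOn ℝ (Set.Icc (x₀ - 2 * ℓ) (x₀ + 2 * ℓ)) (fun y => U y t) :=
    (hCx t htI).concaveOn_Icc fun y hy => hconc y hy t htI
  have hest := hconcave.add_mul_abs_deriv_le hl (fun z hz => hpos z hz t htI) hx
    ((hCx t htI).hasDerivAt_derivWithin_Icc hxI)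
  have hM : 0 < U x₀ t := hpos x₀ hx₀ t htI
  have hsub : Set.Icc t t₀ ⊆ Set.Icc (t₀ - r ^ 2) t₀ := Set.Icc_subset_Icc_left ht.1.le
  -- The function `U² + (x - x₀)² + 2n(s - t)`, constant on shrinking spheres, solves a linear
  -- parabolic equation.
  have hball : (U x₀ t * (2 * ℓ)) ^ 2 / ((2 * ℓ) ^ 2 + U x₀ t ^ 2) ≤
      U x₀ t₀ ^ 2 + (x₀ - x₀) ^ 2 + 2 * (n : ℝ) * (t₀ - t) := by
    have hden : 0 < (2 * ℓ) ^ 2 + U x₀ t ^ 2 := by positivity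
    have hbd : ∀ s ∈ Set.Icc t t₀, ∀ y, (y - x₀) ^ 2 = (2 * ℓ) ^ 2 →
        (U x₀ t * (2 * ℓ)) ^ 2 / ((2 * ℓ) ^ 2 + U x₀ t ^ 2) ≤
          U y s ^ 2 + (y - x₀) ^ 2 + 2 * (n : ℝ) * (s - t) := by
      intro s hs y hy
      have h₁ : 0 ≤ 2 * (n : ℝ) * (s - t) := mul_nonneg (by positivity) (sub_nonneg.2 hs.1)
      have h₂ : (U x₀ t * (2 * ℓ)) ^ 2 / ((2 * ℓ) ^ 2 + U x₀ t ^ 2) ≤ (2 * ℓ) ^ 2 := by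
        rw [div_le_iff₀ hden]
        nlinarith [sq_nonneg ((2 * ℓ) ^ 2)]
      rw [hy]
      linarith [sq_nonneg (U y s)]
    refine parabolic_minimum_principle
      (W := fun y s => U y s ^ 2 + (y - x₀) ^ 2 + 2 * (n : ℝ) * (s - t))
      (a := x₀ - 2 * ℓ) (b := x₀ + 2 * ℓ) (c := t) (d := t₀) ?_ ?_ ?_ ?_ ?_ hx₀
      ⟨ht.2, le_rfl⟩
    · have h := hcont.mono (Set.prod_mono_right hsub)
      exact ((h.pow 2).add (by fun_prop)).add (by fun_prop)
    · intro y hy s hs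
      have hyI := Set.Ioo_subset_Icc_self hy
      have hsI := hsub (Set.Ioc_subset_Icc_self hs)
      have hUpos := hpos y hyI s hsI
      have hxd := (hCx s hsI).hasDerivAt_derivWithin_Icc hy
      refine ⟨by have := hxd.continuousAt; fun_prop, ?_⟩
      have htd : HasDerivWithinAt (fun s' => U y s') (pUt U (Set.Icc (t₀ - r ^ 2) t₀) y s)
          (Set.Icc t t₀) s :=
        (((hCt y hyI).differentiableOn (by norm_num)) s hsI).hasDerivWithinAt.mono hsub
      have hW := ((htd.pow 2).add_const ((y - x₀) ^ 2)).add
        (((hasDerivWithinAt_id s (Set.Icc t t₀)).sub_const t).const_mul (2 * (n : ℝ)))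
      refine ⟨_, 1 / (1 + pUx U (Set.Icc (x₀ - 2 * ℓ) (x₀ + 2 * ℓ)) y s ^ 2),
        by positivity, hW, ?_⟩
      rw [deriv_deriv_sq_add_sq (hCx s hsI) hy, hPDE y hyI s hsI]
      change _ * (2 * pUx U (Set.Icc (x₀ - 2 * ℓ) (x₀ + 2 * ℓ)) y s ^ 2 +
        2 * U y s * pUxx U (Set.Icc (x₀ - 2 * ℓ) (x₀ + 2 * ℓ)) y s + 2) ≤ _
      have hslope : 0 < 1 + pUx U (Set.Icc (x₀ - 2 * ℓ) (x₀ + 2 * ℓ)) y s ^ 2 := by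
        positivity
      refine le_of_eq ?_
      simp only [Nat.cast_ofNat, Nat.add_one_sub_one, pow_one, mul_one]
      field_simp
      ring
    · intro y hy
      have htent := hconcave.mul_sub_abs_le (by linarith : (0 : ℝ) < 2 * ℓ)
        (fun z hz => (hpos z hz t htI).le) hy
      have habs : |y - x₀| ≤ 2 * ℓ := abs_le.2 ⟨by linarith [hy.1], by linarith [hy.2]⟩
      rw [div_le_iff₀ hden]
      have h₁ : U x₀ t * (2 * ℓ) ≤ U y t * (2 * ℓ) + U x₀ t * |y - x₀| := by
        linarith
      have h₂ := pow_le_pow_left₀ (by positivity) h₁ 2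
      have h₃ : |y - x₀| ^ 2 = (y - x₀) ^ 2 := sq_abs _
      nlinarith [sq_nonneg (U y t * U x₀ t - 2 * ℓ * |y - x₀|)]
    · exact fun s hs => hbd s hs _ (by ring)
    · exact fun s hs => hbd s hs _ (by ring)
  have hsmall : (U x₀ t * (2 * ℓ)) ^ 2 ≤ (q * r) ^ 2 * ((2 * ℓ) ^ 2 + U x₀ t ^ 2) := by
    rw [← div_le_iff₀ (by positivity)]
    refine hball.trans ?_
    have : 2 * (n : ℝ) * (t₀ - t) ≤ 2 * (n : ℝ) * r ^ 2 :=
      mul_le_mul_of_nonneg_left (by linarith [ht.1]) (by positivity)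
    rw [hU0, mul_pow, hqsq]
    nlinarith
  have hmid : U x₀ t ≤ 2 * (q * r) := by
    refine (sq_le_sq₀ hM.le (by positivity)).1 ?_
    have hℓsq : (q * r) ^ 2 ≤ ℓ ^ 2 := pow_le_pow_left₀ hqr.le hℓ 2
    have h₁ : (q * r) ^ 2 * U x₀ t ^ 2 ≤ ℓ ^ 2 * U x₀ t ^ 2 :=
      mul_le_mul_of_nonneg_right hℓsq (sq_nonneg _)
    refine le_of_mul_le_mul_left ?_ (by positivity : 0 < ℓ ^ 2)
    nlinarith [mul_nonneg (sq_nonneg ℓ) (sq_nonneg (q * r))]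
  change U x t + ℓ * |derivWithin (fun y => U y t) _ x| ≤ _
  linarith
end
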